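/- For every ε > 0 the following holds: if t = t(n) and b = b(n) satisfy t ≥ (1+ε)·n·log n/2 and b ≥ 9n, then there exists a (t,b)-strategy B of Builder such that the probability that the purchased graph B_t contains a Hamilton cycle tends to 1 as n → ∞. -/

import Mathlib

open Filter

attribute [local instance] Classical.propDecidable

/-- The edges of the complete graph on `Fin n`: non-diagonal unordered pairs. -/
abbrev CEdge (n : ℕ) : Type := {e : Sym2 (Fin n) // ¬ e.IsDiag}

/-- The sample space: a uniformly random ordering of the edges of `K_n`,
encoded as a bijection from positions to edges. -/
abbrev EdgeOrdering (n : ℕ) : Type := Fin (Fintype.card (CEdge n)) ≃ CEdge n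

/-- The uniform probability of an event on a finite sample space. -/
noncomputable def uprob {α : Type} [Fintype α] (P : α → Prop) : ℝ :=
  ((Finset.univ.filter P).card : ℝ) / (Fintype.card α : ℝ)

/-- A (deterministic) strategy of Builder: given the current time `s`, the graph `B_{s-1}`
of previously purchased edges, and the observed edge `e_s`, decide whether to purchase it. -/
def Strategy (n : ℕ) : Type := ℕ → Finset (CEdge n) → CEdge n → Bool

/-- Builder's purchased graph `B_s` at time `s`, playing strategy `S` with budget `b`
on the ordering `ω`.  An edge is purchased iff the strategy accepts it and the budget permits. -/
noncomputable def build (n b : ℕ) (S : Strategy n) (ω : EdgeOrdering n) : ℕ → Finset (CEdge n)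
  | 0 => ∅
  | s + 1 =>
    let P := build n b S ω s
    if h : s < Fintype.card (CEdge n) then
      if S s P (ω ⟨s, h⟩) = true ∧ P.card < b then insert (ω ⟨s, h⟩) P else P
    else P

/-- The degree of the vertex `v` in the graph given by the edge set `P`. -/
noncomputable def edegree (n : ℕ) (P : Finset (CEdge n)) (v : Fin n) : ℕ :=
  (P.filter (fun e => v ∈ (e : Sym2 (Fin n)))).card

/-- The simple graph on `Fin n` determined by a finite set of edges. -/
noncomputable def toGraph (n : ℕ) (P : Finset (CEdge n)) : SimpleGraph (Fin n) :=
  SimpleGraph.fromEdgeSet (↑(P.image Subtype.val))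

/-- The lists of distinct vertices in which consecutive vertices are adjacent. -/
def IsPathList {V : Type} (G : SimpleGraph V) (l : List V) : Prop := l.IsChain G.Adj ∧ l.Nodup

/-- The lists obtained from `l₀` by iterated Pósa rotations moving the head of the list. -/
inductive Rot {V : Type} (G : SimpleGraph V) (l₀ : List V) : List V → Prop
  | refl : Rot G l₀ l₀
  | step (v : V) (a : List V) (z : V) (b : List V) :
      Rot G l₀ (v :: a ++ z :: b) → G.Adj v z → Rot G l₀ (a.reverse ++ v :: z :: b)

lemma isChain_rotate {V : Type} {R : V → V → Prop} (hR : ∀ x y, R x y → R y x)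
    {v z : V} {a b : List V} (h : (v :: a ++ z :: b).IsChain R) (hvz : R v z) :
    (a.reverse ++ v :: z :: b).IsChain R := by
  have h1 : (v :: a).IsChain R := h.left_of_append
  have h2 : (z :: b).IsChain R := h.right_of_append
  rw [List.isChain_append_cons_cons]
  refine ⟨?_, hvz, h2⟩
  rw [← List.reverse_cons, List.isChain_reverse]
  exact h1.imp (fun _ _ => hR _ _)

lemma Rot.perm {V : Type} {G : SimpleGraph V} {l₀ l : List V} (h : Rot G l₀ l) : l.Perm l₀ := by
  induction h with
  | refl => exact List.Perm.refl _
  | step v a z b _ _ ih =>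
    refine List.Perm.trans ?_ ih
    have : (a.reverse ++ v :: z :: b).Perm (v :: (a.reverse ++ z :: b)) := List.perm_middle
    refine this.trans ?_
    simpa using (List.reverse_perm a).append_right (z :: b)

lemma Rot.isPathList {V : Type} {G : SimpleGraph V} {l₀ l : List V} (h : Rot G l₀ l)
    (h₀ : IsPathList G l₀) : IsPathList G l := by
  refine ⟨?_, h.perm.nodup_iff.2 h₀.2⟩
  induction h with
  | refl => exact h₀.1
  | step v a z b _ hvz ih => exact isChain_rotate (fun _ _ h => h.symm) ih hvz

lemma Rot.getLast? {V : Type} {G : SimpleGraph V} {l₀ l : List V} (h : Rot G l₀ l) :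
    l.getLast? = l₀.getLast? := by
  induction h with
  | refl => rfl
  | step v a z b _ _ ih =>
    rw [← ih, List.getLast?_append_cons, List.getLast?_append_cons]; rfl

/-- The set of heads of the rotations of `l₀`. -/
noncomputable def rotEnds {V : Type} [Fintype V] (G : SimpleGraph V) (l₀ : List V) : Finset V :=
  Finset.univ.filter (fun r => ∃ l, Rot G l₀ (r :: l))

/-- The external neighbourhood of a set of vertices. -/
noncomputable def extNbr {V : Type} [Fintype V] (G : SimpleGraph V) (S : Finset V) : Finset V :=
  Finset.univ.filter (fun x => x ∉ S ∧ ∃ v ∈ S, G.Adj v x)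

/-- `a` and `b` occur consecutively in `l`, in one of the two orders. -/
def Consec {V : Type} (l : List V) (a b : V) : Prop := [a, b] <:+: l ∨ [b, a] <:+: l

lemma rotEnds_consec {V : Type} [Fintype V] {G : SimpleGraph V} {l₀ : List V}
    (h₀ : IsPathList G l₀) (hmax : ∀ l, IsPathList G l → l.length ≤ l₀.length)
    {x : V} (hx : x ∈ extNbr G (rotEnds G l₀)) : ∃ y ∈ rotEnds G l₀, Consec l₀ x y := by
  simp only [extNbr, Finset.mem_filter, Finset.mem_univ, true_and] at hx
  obtain ⟨hxE, r, hr, hadj⟩ := hx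
  by_contra! hno
  have hmem : ∀ {l : List V} {y : V}, Rot G l₀ (y :: l) → y ∈ rotEnds G l₀ := by
    intro l y h; simp only [rotEnds, Finset.mem_filter, Finset.mem_univ, true_and]; exact ⟨l, h⟩
  have last_ne : ∀ {R : V → V → Prop} {v : V} {a : List V} {z : V} {b : List V},
      (v :: a ++ z :: b).IsChain R → ∀ c l, a.reverse ++ v :: z :: b = c :: l → R c z := by
    intro R v a z b hc c l h
    have h1 := hc.rel_getLast_head_of_append (by simp) (by simp)
    have h2 : (v :: a).getLast (by simp) = c := by
      have h3 : (v :: a).reverse ++ z :: b = c :: l := by simpa using h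
      have h4 : (v :: a).reverse.head? = some c := by
        have := congrArg List.head? h3
        rw [List.head?_append_of_ne_nil _ (by simp)] at this
        simpa using this
      rw [List.head?_reverse, List.getLast?_eq_some_getLast (by simp)] at h4
      simpa using h4
    rw [h2] at h1
    simpa using h1
  let R : V → V → Prop := fun a b => (a = x ∨ b = x) → Consec l₀ a b
  have hRs : ∀ a b, R a b → R b a := by
    intro a b h h'
    exact (h h'.symm).symm
  have inv : ∀ l, Rot G l₀ l → l.IsChain R := by
    intro l hl
    induction hl with
    | refl =>
      exact (List.isChain_isInfix l₀).imp (fun a b hab _ => Or.inl hab)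
    | step v a z b hl hvz ih =>
      refine isChain_rotate hRs ih ?_
      rintro (rfl | rfl)
      · exact absurd (hmem hl) hxE
      · exfalso
        obtain ⟨c, l', hcl⟩ := List.exists_cons_of_ne_nil
          (show a.reverse ++ v :: z :: b ≠ [] by simp)
        have h1 := last_ne ih c l' hcl
        have h2 := Rot.step v a z b hl hvz
        rw [hcl] at h2
        exact hno c (hmem h2) (h1 (Or.inr rfl)).symm
  simp only [rotEnds, Finset.mem_filter, Finset.mem_univ, true_and] at hr
  obtain ⟨l, hl⟩ := hr
  have hp := hl.isPathList h₀
  by_cases hxl : x ∈ r :: l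
  · rcases List.mem_cons.1 hxl with rfl | hxl
    · exact hxE (hmem hl)
    · obtain ⟨a, b, rfl⟩ := List.append_of_mem hxl
      obtain ⟨c, l', hcl⟩ := List.exists_cons_of_ne_nil
          (show a.reverse ++ r :: x :: b ≠ [] by simp)
      have h1 := last_ne (inv _ hl) c l' hcl
      have h2 := Rot.step r a x b hl hadj
      rw [hcl] at h2
      exact hno c (hmem h2) (h1 (Or.inr rfl)).symm
  · have h1 : IsPathList G (x :: r :: l) :=
      ⟨List.isChain_cons_cons.2 ⟨hadj.symm, hp.1⟩, List.nodup_cons.2 ⟨hxl, hp.2⟩⟩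
    have h2 := hmax _ h1
    have h3 := hl.perm.length_eq
    simp only [List.length_cons] at h2 h3
    omega

lemma infix_pair_left_unique {V : Type} {l : List V} (h : l.Nodup) {a a' b : V}
    (h1 : [a, b] <:+: l) (h2 : [a', b] <:+: l) : a = a' := by
  obtain ⟨s, t, rfl⟩ := h1
  obtain ⟨s', t', h2⟩ := h2
  have h3 : (s ++ [a]) ++ b :: t = (s' ++ [a']) ++ b :: t' := by simpa using h2.symm
  have h4 : b ∉ s ++ [a] := by
    intro hb
    have : (s ++ [a]) ++ b :: t = s ++ [a, b] ++ t := by simp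
    rw [← this, List.nodup_append] at h
    exact h.2.2 b hb b (by simp) rfl
  have h5 : b ∉ s' ++ [a'] := by
    intro hb
    have : (s ++ [a]) ++ b :: t = s ++ [a, b] ++ t := by simp
    rw [← this, h3, List.nodup_append] at h
    exact h.2.2 b hb b (by simp) rfl
  have h6 := List.append_inj_left h3
  have h7 : (s ++ [a]).length = (s' ++ [a']).length := by
    have e1 : List.idxOf b ((s ++ [a]) ++ b :: t) = (s ++ [a]).length := by
      rw [List.idxOf_append_of_notMem h4]; simp
    have e2 : List.idxOf b ((s' ++ [a']) ++ b :: t') = (s' ++ [a']).length := by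
      rw [List.idxOf_append_of_notMem h5]; simp
    rw [← e1, ← e2, h3]
  have h8 := h6 h7
  have h9 := congrArg List.getLast? h8
  simpa using h9

lemma infix_pair_right_unique {V : Type} {l : List V} (h : l.Nodup) {a b b' : V}
    (h1 : [a, b] <:+: l) (h2 : [a, b'] <:+: l) : b = b' := by
  have h1' := List.reverse_infix.2 h1
  have h2' := List.reverse_infix.2 h2
  exact infix_pair_left_unique (List.nodup_reverse.2 h) (by simpa using h1') (by simpa using h2')

lemma card_extNbr_rotEnds_le {V : Type} [Fintype V] {G : SimpleGraph V} {l₀ : List V}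
    (h₀ : IsPathList G l₀) (hmax : ∀ l, IsPathList G l → l.length ≤ l₀.length) :
    (extNbr G (rotEnds G l₀)).card ≤ 2 * (rotEnds G l₀).card := by
  have hsub : extNbr G (rotEnds G l₀) ⊆
      (rotEnds G l₀).biUnion (fun y => Finset.univ.filter (fun x => [x, y] <:+: l₀) ∪
        Finset.univ.filter (fun x => [y, x] <:+: l₀)) := by
    intro x hx
    obtain ⟨y, hy, hc⟩ := rotEnds_consec h₀ hmax hx
    simp only [Finset.mem_biUnion, Finset.mem_union, Finset.mem_filter, Finset.mem_univ, true_and]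
    exact ⟨y, hy, hc⟩
  refine (Finset.card_le_card hsub).trans ?_
  refine Finset.card_biUnion_le.trans ?_
  rw [mul_comm, ← smul_eq_mul]
  refine Finset.sum_le_card_nsmul _ _ _ ?_
  intro y _
  refine (Finset.card_union_le _ _).trans ?_
  have e1 : (Finset.univ.filter (fun x => [x, y] <:+: l₀)).card ≤ 1 := by
    rw [Finset.card_le_one]
    intro a ha b hb
    simp only [Finset.mem_filter, Finset.mem_univ, true_and] at ha hb
    exact infix_pair_left_unique h₀.2 ha hb
  have e2 : (Finset.univ.filter (fun x => [y, x] <:+: l₀)).card ≤ 1 := by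
    rw [Finset.card_le_one]
    intro a ha b hb
    simp only [Finset.mem_filter, Finset.mem_univ, true_and] at ha hb
    exact infix_pair_right_unique h₀.2 ha hb
  omega

/-- Every nonempty set of at most `d` vertices has more than twice as many outside neighbours. -/
def Expands {V : Type} [Fintype V] (G : SimpleGraph V) (d : ℕ) : Prop :=
  ∀ S : Finset V, S.Nonempty → S.card ≤ d → 2 * S.card < (extNbr G S).card

/-- The number of vertices of a longest path. -/
noncomputable def longestPath {V : Type} [Fintype V] (G : SimpleGraph V) : ℕ :=
  Nat.findGreatest (fun k => ∃ l, IsPathList G l ∧ l.length = k) (Fintype.card V)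

/-- A measure of the progress towards a Hamilton cycle: the length of a longest path,
plus one when the graph is Hamiltonian. -/
noncomputable def progress {V : Type} [Fintype V] (G : SimpleGraph V) : ℕ :=
  (longestPath G - 1) + if G.IsHamiltonian then 1 else 0

lemma IsPathList.mono {V : Type} {G G' : SimpleGraph V} {l : List V} (hG : G ≤ G')
    (h : IsPathList G l) : IsPathList G' l :=
  ⟨h.1.imp (fun _ _ hab => hG hab), h.2⟩

section Progress

variable {V : Type} [Fintype V] {G G' : SimpleGraph V}

lemma IsPathList.length_le {l : List V} (h : IsPathList G l) : l.length ≤ longestPath G :=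
  Nat.le_findGreatest h.2.length_le_card ⟨l, h, rfl⟩

lemma exists_longestPath (G : SimpleGraph V) :
    ∃ l, IsPathList G l ∧ l.length = longestPath G :=
  Nat.findGreatest_spec (P := fun k => ∃ l, IsPathList G l ∧ l.length = k) (Nat.zero_le _)
    ⟨[], ⟨List.isChain_nil, List.nodup_nil⟩, rfl⟩

lemma longestPath_le (G : SimpleGraph V) : longestPath G ≤ Fintype.card V :=
  Nat.findGreatest_le _

lemma longestPath_mono (hG : G ≤ G') : longestPath G ≤ longestPath G' := by
  obtain ⟨l, hl, hlen⟩ := exists_longestPath G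
  rw [← hlen]
  exact (hl.mono hG).length_le

lemma progress_mono (hG : G ≤ G') : progress G ≤ progress G' := by
  have h1 := longestPath_mono hG
  unfold progress
  by_cases h : G.IsHamiltonian
  · rw [if_pos h, if_pos (h.mono hG)]; omega
  · rw [if_neg h]; omega

lemma progress_le [Nonempty V] (G : SimpleGraph V) : progress G ≤ Fintype.card V := by
  have h1 := longestPath_le G
  have h2 : 0 < Fintype.card V := Fintype.card_pos
  unfold progress
  split_ifs <;> omega

lemma progress_lt_of_not_isHamiltonian [Nonempty V] (h : ¬ G.IsHamiltonian) :
    progress G < Fintype.card V := by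
  have h1 := longestPath_le G
  have h2 : 0 < Fintype.card V := Fintype.card_pos
  unfold progress
  rw [if_neg h]; omega

lemma isHamiltonian_of_isPathList {l : List V} (hl : IsPathList G l) (hne : l ≠ [])
    (hlen : l.length = Fintype.card V) (hV : 3 ≤ Fintype.card V)
    (hadj : G.Adj (l.getLast hne) (l.head hne)) : G.IsHamiltonian := by
  intro _
  let p := SimpleGraph.Walk.ofSupport l hne hl.1
  have hp : p.IsPath := by
    rw [SimpleGraph.Walk.isPath_def, SimpleGraph.Walk.support_ofSupport]
    exact hl.2
  have hpl : p.length = l.length - 1 := SimpleGraph.Walk.length_ofSupport hne hl.1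
  refine ⟨_, SimpleGraph.Walk.cons hadj p, ?_⟩
  rw [SimpleGraph.Walk.isHamiltonianCycle_iff_isCycle_and_length_eq]
  refine ⟨(SimpleGraph.Walk.cons_isCycle_iff _ _).2 ⟨hp, fun h => ?_⟩, ?_⟩
  · rw [Sym2.eq_swap] at h
    have := hp.length_eq_one_of_mem_edges h
    omega
  · rw [SimpleGraph.Walk.length_cons]; omega

lemma card_rotEnds_gt {d : ℕ} (hexp : Expands G d) {l₀ : List V} (hne : l₀ ≠ [])
    (h₀ : IsPathList G l₀) (hmax : ∀ l, IsPathList G l → l.length ≤ l₀.length) :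
    d < (rotEnds G l₀).card := by
  by_contra! h
  have hn : (rotEnds G l₀).Nonempty := by
    obtain ⟨r, l, rfl⟩ := List.exists_cons_of_ne_nil hne
    exact ⟨r, by
      simp only [rotEnds, Finset.mem_filter, Finset.mem_univ, true_and]; exact ⟨l, Rot.refl⟩⟩
  have h1 := hexp _ hn h
  have h2 := card_extNbr_rotEnds_le h₀ hmax
  omega

/-- Closing a longest path of a graph without Hamilton cycle increases the progress, unless
the vertices of the path form a component. -/
lemma progress_lt_of_adj_ends (hV : 3 ≤ Fintype.card V) (hnH : ¬ G.IsHamiltonian) (hG : G ≤ G')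
    {l : List V} (hl : IsPathList G l) (hne : l ≠ []) (hlen : l.length = longestPath G)
    (hadj : G'.Adj (l.getLast hne) (l.head hne))
    (hout : l.length = Fintype.card V ∨ ∃ z ∈ l, ∃ y, y ∉ l ∧ G.Adj z y) :
    progress G < progress G' := by
  have hpos : 0 < l.length := List.length_pos_iff.2 hne
  rcases hout with hout | ⟨z, hz, y, hy, hzy⟩
  · have h1 := isHamiltonian_of_isPathList (hl.mono hG) hne hout hV hadj
    have h2 := longestPath_mono hG
    unfold progress
    rw [if_neg hnH, if_pos h1]
    omega
  · obtain ⟨a, b, rfl⟩ := List.append_of_mem hz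
    have hp' := hl.mono hG
    have h1 : IsPathList G' (y :: (z :: b ++ a)) := by
      constructor
      · rw [List.cons_append, List.isChain_cons_cons]
        refine ⟨(hG hzy).symm, ?_⟩
        rw [← List.cons_append]
        refine List.IsChain.append hp'.1.right_of_append hp'.1.left_of_append ?_
        intro u hu v hv
        have e1 : (a ++ z :: b).getLast hne = u := by
          have := List.getLast?_append_cons a z b
          rw [Option.mem_def.1 hu, List.getLast?_eq_some_getLast hne] at this
          simpa using this
        have e2 : (a ++ z :: b).head hne = v := by
          rw [← Option.some_inj, ← List.head?_eq_some_head hne]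
          cases a with
          | nil => simp at hv
          | cons c a => simpa using hv
        rwa [e1, e2] at hadj
      · rw [List.nodup_cons]
        refine ⟨fun h => hy ?_, ?_⟩
        · simp only [List.mem_append, List.mem_cons] at h ⊢; tauto
        · exact (List.perm_append_comm.nodup_iff).1 hl.2
    have h2 := h1.length_le
    simp only [List.length_cons, List.length_append] at h2 hlen hpos
    unfold progress
    rw [if_neg hnH]
    split_ifs <;> omega

lemma progress_lt_of_adj_outside (hnH : ¬ G.IsHamiltonian) (hG : G ≤ G')
    {r x : V} {l : List V} (hl : IsPathList G (r :: l)) (hlen : (r :: l).length = longestPath G)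
    (hx : x ∉ r :: l) (hadj : G'.Adj r x) : progress G < progress G' := by
  have h1 : IsPathList G' (x :: r :: l) :=
    ⟨List.isChain_cons_cons.2 ⟨hadj.symm, (hl.mono hG).1⟩, List.nodup_cons.2 ⟨hx, hl.2⟩⟩
  have h2 := h1.length_le
  simp only [List.length_cons] at h2 hlen
  unfold progress
  rw [if_neg hnH]
  split_ifs <;> omega

/-- A non-Hamiltonian expander has quadratically many boosters. -/
theorem exists_boosters {d : ℕ} (hV : 3 ≤ Fintype.card V) (hexp : Expands G d)
    (hnH : ¬ G.IsHamiltonian) :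
    ∃ Q : Finset (V × V), d * d ≤ Q.card ∧ ∀ p ∈ Q, p.1 ≠ p.2 ∧
      ∀ G' : SimpleGraph V, G ≤ G' → G'.Adj p.1 p.2 → progress G < progress G' := by
  have hVne : Nonempty V := Fintype.card_pos_iff.1 (by omega)
  rcases Nat.eq_zero_or_pos d with rfl | hd
  · exact ⟨∅, by simp, by simp⟩
  obtain ⟨l₀, h₀, hlen₀⟩ := exists_longestPath G
  have hmax : ∀ l, IsPathList G l → l.length ≤ l₀.length := fun l hl => hlen₀ ▸ hl.length_le
  have hne₀ : l₀ ≠ [] := by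
    have : IsPathList G [hVne.some] := ⟨List.isChain_singleton _, List.nodup_singleton _⟩
    have := hmax _ this
    intro h; simp [h] at this
  have hR := card_rotEnds_gt hexp hne₀ h₀ hmax
  have hlong : 2 ≤ l₀.length := by
    have h1 : rotEnds G l₀ ⊆ l₀.toFinset := by
      intro r hr
      simp only [rotEnds, Finset.mem_filter, Finset.mem_univ, true_and] at hr
      obtain ⟨l, hl⟩ := hr
      rw [List.mem_toFinset]
      exact hl.perm.mem_iff.1 (by simp)
    have h2 := (Finset.card_le_card h1).trans (List.toFinset_card_le l₀)
    omega
  let Q : Finset (V × V) := Finset.univ.filter (fun p => p.1 ≠ p.2 ∧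
      ∀ G' : SimpleGraph V, G ≤ G' → G'.Adj p.1 p.2 → progress G < progress G')
  refine ⟨Q, ?_, fun p hp => (Finset.mem_filter.1 hp).2⟩
  have key : ∀ r ∈ rotEnds G l₀,
      d ≤ (Finset.univ.filter (fun x => (r, x) ∈ Q)).card := by
    intro r hr
    simp only [rotEnds, Finset.mem_filter, Finset.mem_univ, true_and] at hr
    obtain ⟨l, hl⟩ := hr
    have hpl := hl.isPathList h₀
    have hll := hl.perm.length_eq
    by_cases hout : l₀.length = Fintype.card V ∨ ∃ z ∈ l₀, ∃ y, y ∉ l₀ ∧ G.Adj z y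
    · have hrev : IsPathList G (r :: l).reverse :=
        ⟨List.isChain_reverse.2 (hpl.1.imp fun _ _ h => h.symm), List.nodup_reverse.2 hpl.2⟩
      have hlr : (r :: l).reverse.length = l₀.length := by rw [List.length_reverse, hll]
      have h1 := card_rotEnds_gt hexp (by simp) hrev (fun l hl => by rw [hlr]; exact hmax l hl)
      refine h1.le.trans (Finset.card_le_card ?_)
      intro x hx
      simp only [rotEnds, Finset.mem_filter, Finset.mem_univ, true_and] at hx
      obtain ⟨l', hl'⟩ := hx
      have hp' := hl'.isPathList hrev
      have hperm : (x :: l').Perm l₀ := hl'.perm.trans ((List.reverse_perm _).trans hl.perm)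
      have hlast : (x :: l').getLast (by simp) = r := by
        have := hl'.getLast?
        rw [List.getLast?_reverse, List.getLast?_eq_some_getLast (by simp)] at this
        simpa using this
      simp only [Q, Finset.mem_filter, Finset.mem_univ, true_and]
      have hl'ne : l' ≠ [] := by
        rintro rfl
        have := hperm.length_eq
        simp only [List.length_cons, List.length_nil] at this
        omega
      refine ⟨?_, fun G' hG hadj => ?_⟩
      · rintro rfl
        rw [List.getLast_cons hl'ne] at hlast
        have h2 := List.getLast_mem hl'ne
        rw [hlast] at h2
        exact (List.nodup_cons.1 hp'.2).1 h2
      · refine progress_lt_of_adj_ends hV hnH hG hp' (by simp) (hperm.length_eq.trans hlen₀) ?_ ?_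
        · rw [hlast]; exact hadj
        · rcases hout with h | ⟨z, hz, y, hy, hzy⟩
          · exact Or.inl (hperm.length_eq.trans h)
          · exact Or.inr ⟨z, hperm.mem_iff.2 hz, y, fun h => hy (hperm.mem_iff.1 h), hzy⟩
    · push Not at hout
      obtain ⟨hlt, hcl⟩ := hout
      let U : Finset V := Finset.univ.filter (fun x => x ∉ l₀)
      have hU : U.Nonempty := by
        by_contra hU
        rw [Finset.not_nonempty_iff_eq_empty, Finset.filter_eq_empty_iff] at hU
        have h1 : (Finset.univ : Finset V) ⊆ l₀.toFinset := fun x hx => by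
          have := hU hx
          rw [List.mem_toFinset]; tauto
        have h2 := (Finset.card_le_card h1).trans (List.toFinset_card_le l₀)
        rw [Finset.card_univ] at h2
        have h3 := h₀.2.length_le_card
        omega
      have hUd : d < U.card := by
        by_contra! h
        have h1 := hexp U hU h
        have h2 : extNbr G U = ∅ := by
          rw [extNbr, Finset.filter_eq_empty_iff]
          rintro x - ⟨hx, v, hv, hvx⟩
          simp only [U, Finset.mem_filter, Finset.mem_univ, true_and, not_not] at hx hv
          exact hcl x hx v hv hvx.symm
        rw [h2] at h1
        simp at h1
      refine hUd.le.trans (Finset.card_le_card ?_)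
      intro x hx
      simp only [U, Finset.mem_filter, Finset.mem_univ, true_and] at hx
      have hx' : x ∉ r :: l := fun h => hx (hl.perm.mem_iff.1 h)
      simp only [Q, Finset.mem_filter, Finset.mem_univ, true_and]
      refine ⟨?_, fun G' hG hadj => ?_⟩
      · rintro rfl; simp at hx'
      · exact progress_lt_of_adj_outside hnH hG hpl (hll.trans hlen₀) hx' hadj
  calc d * d ≤ (rotEnds G l₀).card * d := Nat.mul_le_mul_right _ hR.le
    _ ≤ ∑ r ∈ rotEnds G l₀, (Finset.univ.filter (fun x => (r, x) ∈ Q)).card := by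
        rw [← smul_eq_mul]; exact Finset.card_nsmul_le_sum _ _ _ key
    _ = ((rotEnds G l₀).sigma (fun r => Finset.univ.filter (fun x => (r, x) ∈ Q))).card :=
        (Finset.card_sigma _ _).symm
    _ ≤ Q.card := by
        refine Finset.card_le_card_of_injOn (fun p => (p.1, p.2)) ?_ ?_
        · rintro ⟨r, x⟩ h
          have h := Finset.mem_sigma.1 h
          exact (Finset.mem_filter.1 h.2).2
        · rintro ⟨r, x⟩ _ ⟨r', x'⟩ _ h
          simp only [Prod.mk.injEq] at h
          obtain ⟨rfl, rfl⟩ := h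
          rfl

end Progress

/-- Double counting along a family of permutations of the sample space. -/
lemma sum_ite_mul_card {Ω ι : Type} [Fintype Ω] (X : Finset ι) (τ : ι → Equiv.Perm Ω)
    (φ : Ω → ℝ) (hφ : ∀ x ∈ X, ∀ ω, φ (τ x ω) = φ ω) (E : Ω → Prop) :
    (∑ ω, if E ω then φ ω else 0) * X.card
      = ∑ ω, φ ω * (X.filter (fun x => E (τ x ω))).card := by
  have h1 : ∀ x ∈ X, (∑ ω, if E ω then φ ω else 0) = ∑ ω, if E (τ x ω) then φ ω else 0 := by
    intro x hx
    rw [← Equiv.sum_comp (τ x)]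
    exact Finset.sum_congr rfl (fun ω _ => by rw [hφ x hx])
  calc (∑ ω, if E ω then φ ω else 0) * X.card
      = ∑ x ∈ X, ∑ ω, if E ω then φ ω else 0 := by
        rw [Finset.sum_const, nsmul_eq_mul, mul_comm]
    _ = ∑ x ∈ X, ∑ ω, if E (τ x ω) then φ ω else 0 := Finset.sum_congr rfl h1
    _ = ∑ ω, ∑ x ∈ X, if E (τ x ω) then φ ω else 0 := Finset.sum_comm
    _ = _ := by
        refine Finset.sum_congr rfl (fun ω _ => ?_)
        rw [← Finset.sum_filter, Finset.sum_const, nsmul_eq_mul, mul_comm]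

/-- Exchanging the positions `i` and `j` of an ordering. -/
noncomputable def swapPos {α β : Type} (i j : α) : Equiv.Perm (α ≃ β) :=
  Function.Involutive.toPerm (fun ω => (Equiv.swap i j).trans ω)
    (fun ω => by ext x; simp)

/-- Exchanging the entries `f` and `g` of an ordering. -/
noncomputable def swapEntry {α β : Type} (f g : β) : Equiv.Perm (α ≃ β) :=
  Function.Involutive.toPerm (fun ω => ω.trans (Equiv.swap f g))
    (fun ω => by ext x; simp)

lemma swapPos_apply {α β : Type} (i j : α) (ω : α ≃ β) (x : α) :
    swapPos i j ω x = ω (Equiv.swap i j x) := rfl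

lemma swapPos_apply_left {α β : Type} (i j : α) (ω : α ≃ β) : swapPos i j ω i = ω j := by
  rw [swapPos_apply, Equiv.swap_apply_left]

lemma swapPos_apply_of_ne {α β : Type} {i j x : α} (ω : α ≃ β) (hi : x ≠ i) (hj : x ≠ j) :
    swapPos i j ω x = ω x := by
  rw [swapPos_apply, Equiv.swap_apply_of_ne_of_ne hi hj]

lemma swapEntry_symm_apply {α β : Type} (f g : β) (ω : α ≃ β) (x : β) :
    (swapEntry f g ω).symm x = ω.symm (Equiv.swap f g x) := by
  rw [Equiv.symm_apply_eq]
  change x = Equiv.swap f g (ω (ω.symm (Equiv.swap f g x)))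
  simp

/-- The orderings `ω` and `ω'` have the same first `s` entries. -/
def AgreeBefore {N : ℕ} {β : Type} (s : ℕ) (ω ω' : Fin N ≃ β) : Prop :=
  ∀ i : Fin N, (i : ℕ) < s → ω i = ω' i

/-- Given the first `s` entries, the next one is uniform among the remaining ones. -/
lemma sum_ite_next_mem {N : ℕ} {β : Type} [Fintype (Fin N ≃ β)] {s : ℕ} (hs : s < N)
    (φ : (Fin N ≃ β) → ℝ) (Q : (Fin N ≃ β) → Finset β)
    (hφ : ∀ ω ω', AgreeBefore s ω ω' → φ ω = φ ω')
    (hQ : ∀ ω ω', AgreeBefore s ω ω' → Q ω = Q ω') :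
    (∑ ω, if ω ⟨s, hs⟩ ∈ Q ω then φ ω else 0) * ((N : ℝ) - s)
      = ∑ ω, φ ω * (Finset.univ.filter (fun j : Fin N => s ≤ (j : ℕ) ∧ ω j ∈ Q ω)).card := by
  have hag : ∀ j : Fin N, s ≤ (j : ℕ) → ∀ ω : Fin N ≃ β,
      AgreeBefore s (swapPos ⟨s, hs⟩ j ω) ω := by
    intro j hj ω i hi
    refine swapPos_apply_of_ne ω ?_ ?_
    · rintro rfl; simp at hi
    · rintro rfl; omega
  have h := sum_ite_mul_card (Finset.univ.filter (fun j : Fin N => s ≤ (j : ℕ)))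
    (fun j => swapPos ⟨s, hs⟩ j) φ
    (fun j hj ω => hφ _ _ (hag j (Finset.mem_filter.1 hj).2 ω)) (fun ω => ω ⟨s, hs⟩ ∈ Q ω)
  have hc : ((Finset.univ.filter (fun j : Fin N => s ≤ (j : ℕ))).card : ℝ) = (N : ℝ) - s := by
    have : Finset.univ.filter (fun j : Fin N => s ≤ (j : ℕ)) = Finset.Ici ⟨s, hs⟩ := by
      ext j; simp [Fin.le_def]
    rw [this, Fin.card_Ici]
    push_cast [hs.le]
    rfl
  rw [hc] at h
  refine Eq.trans (by congr!) (h.trans ?_)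
  refine Finset.sum_congr rfl (fun ω _ => ?_)
  refine congrArg (fun z : Finset (Fin N) => φ ω * (z.card : ℝ)) ?_
  ext j
  simp only [Finset.mem_filter, Finset.mem_univ, true_and]
  refine and_congr_right (fun hj => ?_)
  rw [hQ _ _ (hag j hj ω), swapPos_apply_left]

/-- At most `k` elements of a finite set have rank less than `k`. -/
lemma card_rank_lt_le {α β : Type} [LinearOrder α] (X : Finset β) (p : β → α)
    (hp : Function.Injective p) (k : ℕ) :
    (X.filter (fun x => (X.filter (fun y => p y < p x)).card < k)).card ≤ k := by
  set A := X.filter (fun x => (X.filter (fun y => p y < p x)).card < k) with hA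
  rcases A.eq_empty_or_nonempty with h | h
  · simp [h]
  · obtain ⟨x, hx, hmax⟩ := A.exists_max_image p h
    have h1 : A.erase x ⊆ X.filter (fun y => p y < p x) := by
      intro y hy
      rw [Finset.mem_erase] at hy
      rw [Finset.mem_filter]
      exact ⟨(Finset.mem_filter.1 hy.2).1, lt_of_le_of_ne (hmax y hy.2) (fun h => hy.1 (hp h))⟩
    have h2 := Finset.card_le_card h1
    have h3 := (Finset.mem_filter.1 hx).2
    rw [Finset.card_erase_of_mem hx] at h2
    omega

/-- Each of the entries `f i` has, independently of the others, a small probability of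
being among the first `k` entries of `insert (f i) (Y i)`. -/
lemma card_early_le {N : ℕ} {β ι : Type} [Fintype (Fin N ≃ β)] (k : ℕ) (m : ℝ) (hm : 0 ≤ m)
    (f : ι → β) (Y : ι → Finset β) (hfY : ∀ i j, f i ∉ Y j) (hf : Function.Injective f)
    (hY : ∀ i j, i ≠ j → Disjoint (Y i) (Y j)) (hcard : ∀ i, m ≤ (Y i).card + 1)
    (I : Finset ι) :
    ((Finset.univ.filter (fun ω : Fin N ≃ β => ∀ i ∈ I,
        ((Y i).filter (fun g => ω.symm g < ω.symm (f i))).card < k)).card : ℝ) * m ^ I.card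
      ≤ (k : ℝ) ^ I.card * Fintype.card (Fin N ≃ β) := by
  let E : ι → (Fin N ≃ β) → Prop := fun i ω =>
    ((Y i).filter (fun g => ω.symm g < ω.symm (f i))).card < k
  have hE : ∀ i, ∀ j, i ≠ j → ∀ x ∈ insert (f i) (Y i), ∀ ω : Fin N ≃ β,
      E j (swapEntry (f i) x ω) ↔ E j ω := by
    intro i j hij x hx ω
    have hx1 : x ≠ f j := by
      rintro rfl
      rcases Finset.mem_insert.1 hx with h | h
      · exact hij (hf h).symm
      · exact hfY _ _ h
    have hx2 : x ∉ Y j := by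
      intro h
      rcases Finset.mem_insert.1 hx with rfl | h'
      · exact hfY _ _ h
      · exact Finset.disjoint_left.1 (hY i j hij) h' h
    have e1 : (swapEntry (f i) x ω).symm (f j) = ω.symm (f j) := by
      rw [swapEntry_symm_apply, Equiv.swap_apply_of_ne_of_ne (fun h => hij (hf h).symm) hx1.symm]
    have e2 : (Y j).filter (fun g => (swapEntry (f i) x ω).symm g < ω.symm (f j))
        = (Y j).filter (fun g => ω.symm g < ω.symm (f j)) := by
      refine Finset.filter_congr (fun g hg => ?_)
      rw [swapEntry_symm_apply, Equiv.swap_apply_of_ne_of_ne]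
      · rintro rfl; exact hfY _ _ hg
      · rintro rfl; exact hx2 hg
    simp only [E, e1, e2]
  have hcount : ∀ i, ∀ ω : Fin N ≃ β,
      ((insert (f i) (Y i)).filter (fun x => E i (swapEntry (f i) x ω))).card ≤ k := by
    intro i ω
    refine le_trans (Finset.card_le_card ?_)
      (card_rank_lt_le (insert (f i) (Y i)) ω.symm ω.symm.injective k)
    intro x hx
    rw [Finset.mem_filter] at hx ⊢
    refine ⟨hx.1, lt_of_le_of_lt ?_ hx.2⟩
    refine Finset.card_le_card_of_injOn (Equiv.swap (f i) x) ?_ (Equiv.injective _).injOn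
    intro y hy
    simp only [Finset.coe_filter, Set.mem_ofPred_eq] at hy ⊢
    rw [swapEntry_symm_apply, swapEntry_symm_apply, Equiv.swap_apply_left, Equiv.swap_apply_self]
    refine ⟨?_, hy.2⟩
    have hyx : y ≠ x := by rintro rfl; exact lt_irrefl _ hy.2
    by_cases hyf : y = f i
    · subst hyf
      rw [Equiv.swap_apply_left]
      rcases Finset.mem_insert.1 hx.1 with h | h
      · exact absurd h.symm hyx
      · exact h
    · rw [Equiv.swap_apply_of_ne_of_ne hyf hyx]
      exact (Finset.mem_insert.1 hy.1).resolve_left hyf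
  induction I using Finset.induction_on with
  | empty => simp
  | insert i I hi ih =>
    set A : Finset (Fin N ≃ β) := Finset.univ.filter (fun ω => ∀ j ∈ I, E j ω) with hA
    have h := sum_ite_mul_card (insert (f i) (Y i)) (fun x => swapEntry (f i) x)
      (fun ω : Fin N ≃ β => if ω ∈ A then (1 : ℝ) else 0)
      (by
        intro x hx ω
        have : swapEntry (f i) x ω ∈ A ↔ ω ∈ A := by
          simp only [hA, Finset.mem_filter, Finset.mem_univ, true_and]
          refine forall₂_congr (fun j hj => hE i j ?_ x hx ω)
          rintro rfl; exact hi hj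
        simp only [this]) (E i)
    have hl : (∑ ω : Fin N ≃ β, if E i ω then (if ω ∈ A then (1 : ℝ) else 0) else 0)
        = ((Finset.univ.filter (fun ω : Fin N ≃ β => ∀ j ∈ insert i I, E j ω)).card : ℝ) := by
      rw [Finset.card_filter]
      push_cast
      refine Finset.sum_congr rfl (fun ω _ => ?_)
      simp only [hA, Finset.mem_filter, Finset.mem_univ, true_and, Finset.forall_mem_insert]
      by_cases h1 : E i ω <;> by_cases h2 : ∀ j ∈ I, E j ω <;> simp [h1, h2]
    replace h := (congrArg (fun z : ℝ => z * ((insert (f i) (Y i)).card : ℝ)) hl).symm.trans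
      (Eq.trans (by congr!) h)
    have hr : (∑ ω : Fin N ≃ β, (if ω ∈ A then (1 : ℝ) else 0) *
        ((insert (f i) (Y i)).filter (fun x => E i (swapEntry (f i) x ω))).card)
        ≤ (A.card : ℝ) * k := by
      calc _ ≤ ∑ ω : Fin N ≃ β, (if ω ∈ A then (1 : ℝ) else 0) * k := by
            refine Finset.sum_le_sum (fun ω _ => ?_)
            refine mul_le_mul_of_nonneg_left (by exact_mod_cast hcount i ω) ?_
            split_ifs <;> norm_num
        _ = (A.card : ℝ) * k := by
            rw [← Finset.sum_mul]
            simp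
    have hci : m ≤ ((insert (f i) (Y i)).card : ℝ) := by
      rw [Finset.card_insert_of_notMem (hfY _ _)]
      exact_mod_cast hcard i
    rw [Finset.card_insert_of_notMem hi, pow_succ, pow_succ]
    calc _ = ((Finset.univ.filter (fun ω : Fin N ≃ β => ∀ j ∈ insert i I, E j ω)).card : ℝ)
            * m * m ^ I.card := by ring
      _ ≤ ((A.card : ℝ) * k) * m ^ I.card := by
          refine mul_le_mul_of_nonneg_right ?_ (by positivity)
          refine le_trans ?_ (h.le.trans (le_trans (le_of_eq (by congr!)) hr))
          exact mul_le_mul_of_nonneg_left hci (by positivity)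
      _ = k * (A.card * m ^ I.card) := by ring
      _ ≤ k * (k ^ I.card * Fintype.card (Fin N ≃ β)) :=
          mul_le_mul_of_nonneg_left ih (by positivity)
      _ = _ := by ring

section Build

variable {n b : ℕ} {S : Strategy n} {ω ω' : EdgeOrdering n} {s s' : ℕ}

lemma build_subset_succ : build n b S ω s ⊆ build n b S ω (s + 1) := by
  intro e he
  simp only [build]
  split_ifs
  · exact Finset.mem_insert_of_mem he
  · exact he
  · exact he

lemma build_mono (h : s ≤ s') : build n b S ω s ⊆ build n b S ω s' := by
  induction s', h using Nat.le_induction with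
  | base => exact Finset.Subset.refl _
  | succ s' _ ih => exact ih.trans build_subset_succ

lemma build_congr (h : AgreeBefore s ω ω') : build n b S ω s = build n b S ω' s := by
  induction s with
  | zero => rfl
  | succ s ih =>
    have h1 := ih (fun i hi => h i (hi.trans (Nat.lt_succ_self _)))
    simp only [build, h1]
    by_cases hs : s < Fintype.card (CEdge n)
    · have h2 := h ⟨s, hs⟩ (Nat.lt_succ_self s)
      simp only [dif_pos hs, h2]
    · simp only [dif_neg hs]

lemma build_succ_of_accept (hs : s < Fintype.card (CEdge n))
    (hS : S s (build n b S ω s) (ω ⟨s, hs⟩) = true) (hb : (build n b S ω s).card < b) :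
    build n b S ω (s + 1) = insert (ω ⟨s, hs⟩) (build n b S ω s) := by
  simp only [build]
  rw [dif_pos hs, if_pos ⟨hS, hb⟩]

/-- Each step either purchases an accepted edge or leaves the purchased graph unchanged. -/
lemma build_succ_cases :
    (∃ e, S s (build n b S ω s) e = true ∧
      build n b S ω (s + 1) = insert e (build n b S ω s)) ∨
    build n b S ω (s + 1) = build n b S ω s := by
  simp only [build]
  split_ifs with h1 h2
  · exact Or.inl ⟨_, h2.1, rfl⟩
  · exact Or.inr rfl
  · exact Or.inr rfl

lemma exists_of_mem_build {e : CEdge n} (he : e ∈ build n b S ω s) :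
    ∃ i : Fin (Fintype.card (CEdge n)), (i : ℕ) < s ∧ ω i = e := by
  induction s with
  | zero => simp [build] at he
  | succ s ih =>
    simp only [build] at he
    split_ifs at he with h1 h2
    · rcases Finset.mem_insert.1 he with rfl | he
      · exact ⟨⟨s, h1⟩, Nat.lt_succ_self s, rfl⟩
      · obtain ⟨i, hi, h⟩ := ih he
        exact ⟨i, hi.trans (Nat.lt_succ_self _), h⟩
    · obtain ⟨i, hi, h⟩ := ih he
      exact ⟨i, hi.trans (Nat.lt_succ_self _), h⟩
    · obtain ⟨i, hi, h⟩ := ih he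
      exact ⟨i, hi.trans (Nat.lt_succ_self _), h⟩

end Build

lemma toGraph_adj {n : ℕ} {P : Finset (CEdge n)} {u v : Fin n} :
    (toGraph n P).Adj u v ↔ ∃ e ∈ P, (e : Sym2 (Fin n)) = s(u, v) := by
  simp only [toGraph, SimpleGraph.fromEdgeSet_adj, Finset.coe_image, Set.mem_image,
    Finset.mem_coe]
  constructor
  · rintro ⟨h, -⟩; exact h
  · rintro ⟨e, he, h⟩
    refine ⟨⟨e, he, h⟩, ?_⟩
    rintro rfl
    exact e.2 (by rw [h]; exact Sym2.mk_isDiag_iff.2 rfl)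

lemma toGraph_mono {n : ℕ} {P P' : Finset (CEdge n)} (h : P ⊆ P') :
    toGraph n P ≤ toGraph n P' := by
  intro u v huv
  rw [toGraph_adj] at huv ⊢
  obtain ⟨e, he, h'⟩ := huv
  exact ⟨e, h he, h'⟩

/-- The number of edges at `v` among the first `s` edges of the ordering. -/
noncomputable def degBefore {n : ℕ} (ω : EdgeOrdering n) (s : ℕ) (v : Fin n) : ℕ :=
  (Finset.univ.filter (fun i : Fin (Fintype.card (CEdge n)) =>
    (i : ℕ) < s ∧ v ∈ (ω i : Sym2 (Fin n)))).card

lemma degBefore_congr {n : ℕ} {ω ω' : EdgeOrdering n} {s : ℕ} (h : AgreeBefore s ω ω')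
    (v : Fin n) : degBefore ω s v = degBefore ω' s v := by
  unfold degBefore
  refine congrArg _ ?_
  ext i
  simp only [Finset.mem_filter, Finset.mem_univ, true_and]
  exact and_congr_right (fun hi => by rw [h i hi])

lemma degBefore_succ {n : ℕ} (ω : EdgeOrdering n) {s : ℕ} (hs : s < Fintype.card (CEdge n))
    (v : Fin n) : degBefore ω (s + 1) v
      = degBefore ω s v + if v ∈ (ω ⟨s, hs⟩ : Sym2 (Fin n)) then 1 else 0 := by
  unfold degBefore
  have h1 : Finset.univ.filter (fun i : Fin (Fintype.card (CEdge n)) =>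
      (i : ℕ) < s + 1 ∧ v ∈ (ω i : Sym2 (Fin n)))
      = Finset.univ.filter (fun i : Fin (Fintype.card (CEdge n)) =>
        (i : ℕ) < s ∧ v ∈ (ω i : Sym2 (Fin n))) ∪
        Finset.univ.filter (fun i => i = ⟨s, hs⟩ ∧ v ∈ (ω ⟨s, hs⟩ : Sym2 (Fin n))) := by
    ext i
    simp only [Finset.mem_filter, Finset.mem_univ, true_and, Finset.mem_union]
    constructor
    · rintro ⟨h, hv⟩
      rcases Nat.lt_succ_iff_lt_or_eq.1 h with h | h
      · exact Or.inl ⟨h, hv⟩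
      · have : i = ⟨s, hs⟩ := Fin.ext h
        exact Or.inr ⟨this, this ▸ hv⟩
    · rintro (⟨h, hv⟩ | ⟨rfl, hv⟩)
      · exact ⟨h.trans (Nat.lt_succ_self _), hv⟩
      · exact ⟨Nat.lt_succ_self s, hv⟩
  rw [h1, Finset.card_union_of_disjoint]
  · congr 1
    split_ifs with h
    · simp [h, Finset.filter_eq']
    · simp [h]
  · rw [Finset.disjoint_left]
    intro i hi hi'
    simp only [Finset.mem_filter, Finset.mem_univ, true_and] at hi hi'
    obtain ⟨rfl, -⟩ := hi'
    exact lt_irrefl _ hi.1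

/-- The number of edges of `P` at `v`. -/
noncomputable def purchasedDeg (n : ℕ) (P : Finset (CEdge n)) (v : Fin n) : ℕ :=
  (P.filter (fun e : CEdge n => v ∈ (e : Sym2 (Fin n)))).card

lemma purchasedDeg_build_le {n b : ℕ} {S : Strategy n} (ω : EdgeOrdering n) (s : ℕ) (v : Fin n) :
    purchasedDeg n (build n b S ω s) v ≤ degBefore ω s v := by
  unfold purchasedDeg degBefore
  refine Finset.card_le_card_of_surjOn ω ?_
  intro e he
  simp only [Finset.coe_filter, Set.mem_ofPred_eq] at he
  obtain ⟨i, hi, rfl⟩ := exists_of_mem_build he.1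
  exact ⟨i, by simpa using ⟨hi, he.2⟩, rfl⟩

/-- Before time `t₁` Builder purchases the edges meeting a vertex of degree less than `8`, and
afterwards the edges which increase the progress towards a Hamilton cycle. -/
noncomputable def hamStrategy (n t₁ : ℕ) : Strategy n := fun s P e =>
  if s < t₁ then decide (∃ v ∈ (e : Sym2 (Fin n)), purchasedDeg n P v < 8)
  else decide (progress (toGraph n P) < progress (toGraph n (insert e P)))

section HamStrategy

variable {n b t₁ : ℕ} (ω : EdgeOrdering n)

lemma purchasedDeg_mono {P P' : Finset (CEdge n)} (h : P ⊆ P') (v : Fin n) :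
    purchasedDeg n P v ≤ purchasedDeg n P' v :=
  Finset.card_le_card (Finset.filter_subset_filter _ h)

lemma card_build_le_sum {s : ℕ} (hs : s ≤ t₁) :
    (build n b (hamStrategy n t₁) ω s).card
      ≤ ∑ v, min (purchasedDeg n (build n b (hamStrategy n t₁) ω s) v) 8 := by
  induction s with
  | zero => simp [build]
  | succ s ih =>
    have ih := ih (by omega)
    rcases build_succ_cases (n := n) (b := b) (S := hamStrategy n t₁) (ω := ω) (s := s) with
      ⟨e, he, h⟩ | h
    · rw [h]
      set P := build n b (hamStrategy n t₁) ω s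
      by_cases heP : e ∈ P
      · rw [Finset.insert_eq_self.2 heP]; exact ih
      rw [Finset.card_insert_of_notMem heP]
      simp only [hamStrategy, if_pos (show s < t₁ by omega), decide_eq_true_eq] at he
      obtain ⟨v, hv, hdeg⟩ := he
      refine lt_of_le_of_lt ih ?_
      refine Finset.sum_lt_sum (fun u _ => min_le_min_right _
        (purchasedDeg_mono (Finset.subset_insert _ _) u)) ⟨v, Finset.mem_univ _, ?_⟩
      have : purchasedDeg n (insert e P) v = purchasedDeg n P v + 1 := by
        unfold purchasedDeg
        rw [Finset.filter_insert, if_pos hv, Finset.card_insert_of_notMem]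
        intro h; exact heP (Finset.mem_filter.1 h).1
      rw [this]
      omega
    · rw [h]; exact ih

lemma card_build_le_of_le {s : ℕ} (hs : s ≤ t₁) :
    (build n b (hamStrategy n t₁) ω s).card ≤ 8 * n := by
  refine (card_build_le_sum ω hs).trans ?_
  refine (Finset.sum_le_card_nsmul _ _ 8 (fun v _ => min_le_right _ _)).trans ?_
  simp [mul_comm]

lemma card_build_le_of_ge {s : ℕ} (hs : t₁ ≤ s) :
    (build n b (hamStrategy n t₁) ω s).card
      ≤ 8 * n + progress (toGraph n (build n b (hamStrategy n t₁) ω s)) := by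
  induction s, hs using Nat.le_induction with
  | base => exact (card_build_le_of_le ω le_rfl).trans (Nat.le_add_right _ _)
  | succ s hs ih =>
    rcases build_succ_cases (n := n) (b := b) (S := hamStrategy n t₁) (ω := ω) (s := s) with
      ⟨e, he, h⟩ | h
    · rw [h]
      simp only [hamStrategy, if_neg (show ¬ s < t₁ by omega), decide_eq_true_eq] at he
      have := Finset.card_insert_le e (build n b (hamStrategy n t₁) ω s)
      omega
    · rw [h]; exact ih

/-- The first eight edges at each vertex are purchased. -/
lemma mem_build_of_degBefore_lt (hb : 9 * n ≤ b) {v : Fin n}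
    {i : Fin (Fintype.card (CEdge n))} (hi : (i : ℕ) < t₁) (hv : v ∈ (ω i : Sym2 (Fin n)))
    (hdeg : degBefore ω i v < 8) : ω i ∈ build n b (hamStrategy n t₁) ω t₁ := by
  refine build_mono (Nat.succ_le_of_lt hi) ?_
  rw [build_succ_of_accept i.2]
  · exact Finset.mem_insert_self _ _
  · simp only [hamStrategy, if_pos hi, decide_eq_true_eq]
    exact ⟨v, hv, lt_of_le_of_lt (purchasedDeg_build_le ω i v) hdeg⟩
  · have := card_build_le_of_le (b := b) ω hi.le
    have := v.pos
    omega

/-- After time `t₁`, an edge which increases the progress is purchased. -/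
lemma progress_build_succ (hn : 0 < n) (hb : 9 * n ≤ b) {s : ℕ} (hs : t₁ ≤ s)
    (hsN : s < Fintype.card (CEdge n))
    (hnH : ¬ (toGraph n (build n b (hamStrategy n t₁) ω s)).IsHamiltonian)
    (hp : progress (toGraph n (build n b (hamStrategy n t₁) ω s)) < progress
      (toGraph n (insert (ω ⟨s, hsN⟩) (build n b (hamStrategy n t₁) ω s)))) :
    progress (toGraph n (build n b (hamStrategy n t₁) ω s)) <
      progress (toGraph n (build n b (hamStrategy n t₁) ω (s + 1))) := by
  have : Nonempty (Fin n) := ⟨⟨0, hn⟩⟩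
  rw [build_succ_of_accept hsN]
  · exact hp
  · simp only [hamStrategy, if_neg (show ¬ s < t₁ by omega), decide_eq_true_eq]
    exact hp
  · have h1 := card_build_le_of_ge (b := b) ω hs
    have h2 := progress_lt_of_not_isHamiltonian
      (G := toGraph n (build n b (hamStrategy n t₁) ω s)) (by convert! hnH)
    rw [Fintype.card_fin] at h2
    omega

end HamStrategy

/-- The number of elements of `Q` among the first `s` entries of an ordering. -/
noncomputable def countBefore {N : ℕ} {β : Type} (ω : Fin N ≃ β) (s : ℕ) (Q : Finset β) : ℕ :=
  (Finset.univ.filter (fun j : Fin N => (j : ℕ) < s ∧ ω j ∈ Q)).card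

lemma countBefore_le {N : ℕ} {β : Type} (ω : Fin N ≃ β) (s : ℕ) (Q : Finset β) :
    countBefore ω s Q ≤ s := by
  unfold countBefore
  rw [← Finset.card_range s]
  refine Finset.card_le_card_of_injOn (fun j => (j : ℕ)) ?_ Fin.val_injective.injOn
  intro j hj
  simp only [Finset.coe_filter, Set.mem_ofPred_eq] at hj
  simpa using hj.2.1

lemma card_eq_card_add_countBefore {N : ℕ} {β : Type} (ω : Fin N ≃ β) (s : ℕ) (Q : Finset β) :
    Q.card = (Finset.univ.filter (fun j : Fin N => s ≤ (j : ℕ) ∧ ω j ∈ Q)).card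
      + countBefore ω s Q := by
  unfold countBefore
  have h : Q.card = (Finset.univ.filter (fun j : Fin N => ω j ∈ Q)).card := by
    rw [← Finset.card_map ω.symm.toEmbedding]
    congr 1
    ext j
    simp
  rw [h, ← Finset.card_filter_add_card_filter_not (fun j : Fin N => s ≤ (j : ℕ)),
    Finset.filter_filter, Finset.filter_filter]
  simp only [and_comm, not_le]

/-- If at least `q` elements of `Q` are still to come, then the next entry belongs to `Q` with
probability at least `q / N`. -/
lemma sum_mul_le_sum_indicator_next {N : ℕ} {β : Type} [Fintype (Fin N ≃ β)] {s : ℕ} (hs : s < N)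
    (φ : (Fin N ≃ β) → ℝ) (Q : (Fin N ≃ β) → Finset β)
    (hφ : ∀ ω ω', AgreeBefore s ω ω' → φ ω = φ ω')
    (hQ : ∀ ω ω', AgreeBefore s ω ω' → Q ω = Q ω') (hφ0 : ∀ ω, 0 ≤ φ ω) (q : ℝ)
    (hq : ∀ ω, φ ω ≠ 0 → q + countBefore ω s (Q ω) ≤ (Q ω).card) :
    (∑ ω, φ ω) * (q / N) ≤ ∑ ω, Set.indicator {ω | ω ⟨s, hs⟩ ∈ Q ω} φ ω := by
  have h2 := sum_ite_next_mem hs φ Q hφ hQ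
  have h3 : ∀ ω, φ ω * q ≤ φ ω * (Finset.univ.filter
      (fun j : Fin N => s ≤ (j : ℕ) ∧ ω j ∈ Q ω)).card := by
    intro ω
    by_cases hd : φ ω = 0
    · simp [hd]
    · refine mul_le_mul_of_nonneg_left ?_ (hφ0 ω)
      have h4 := hq ω hd
      rw [card_eq_card_add_countBefore ω s (Q ω)] at h4
      push_cast at h4
      linarith
  have h4 := Finset.sum_le_sum (fun ω (_ : ω ∈ Finset.univ) => h3 ω)
  rw [← h2, ← Finset.sum_mul] at h4
  have h5 : ∑ ω, Set.indicator {ω | ω ⟨s, hs⟩ ∈ Q ω} φ ω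
      = ∑ ω, if ω ⟨s, hs⟩ ∈ Q ω then φ ω else 0 :=
    Finset.sum_congr rfl (fun ω _ => by simp only [Set.indicator_apply, Set.mem_ofPred_eq])
  rw [h5]
  have hA0 : 0 ≤ ∑ ω, if ω ⟨s, hs⟩ ∈ Q ω then φ ω else 0 := Finset.sum_nonneg (fun ω _ => by
    split_ifs
    · exact hφ0 ω
    · exact le_rfl)
  have hs' : (s : ℝ) < N := by exact_mod_cast hs
  have hs0 : (0 : ℝ) ≤ s := Nat.cast_nonneg s
  rw [← mul_div_assoc, div_le_iff₀ (by linarith)]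
  exact h4.trans (mul_le_mul_of_nonneg_left (by linarith) hA0)
lemma card_cEdge (n : ℕ) : Fintype.card (CEdge n) = n.choose 2 := by
  have h := Sym2.card_subtype_not_diag (α := Fin n)
  rw [Fintype.card_fin] at h
  convert! h

/-- The edge joining two distinct vertices. -/
def mkEdge {n : ℕ} (p : Fin n × Fin n) (h : p.1 ≠ p.2) : CEdge n :=
  ⟨s(p.1, p.2), fun h' => h (Sym2.mk_isDiag_iff.1 h')⟩

/-- The edges at the vertex `v`. -/
noncomputable def edgesAt {n : ℕ} (v : Fin n) : Finset (CEdge n) :=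
  Finset.univ.filter (fun e => v ∈ (e : Sym2 (Fin n)))

lemma mem_edgesAt {n : ℕ} {v : Fin n} {e : CEdge n} : e ∈ edgesAt v ↔ v ∈ (e : Sym2 (Fin n)) := by
  simp [edgesAt]

lemma le_card_edgesAt {n : ℕ} (v : Fin n) : n ≤ (edgesAt v).card + 1 := by
  have h : (Finset.univ.erase v).card ≤ (edgesAt v).card := by
    rw [← Finset.card_attach]
    refine Finset.card_le_card_of_injOn
      (fun u => mkEdge (v, u.1) (Finset.ne_of_mem_erase u.2).symm) ?_ ?_
    · intro u _
      simp [mem_edgesAt, mkEdge]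
    · intro u _ u' _ h
      have h' := congrArg Subtype.val h
      simp only [mkEdge, Sym2.eq_iff] at h'
      ext
      rcases h' with ⟨-, h⟩ | ⟨h1, h2⟩
      · rw [h]
      · rw [← h1, h2]
  rw [Finset.card_erase_of_mem (Finset.mem_univ v), Finset.card_univ, Fintype.card_fin] at h
  omega

/-- A vertex has small degree with exponentially small probability. -/
lemma card_degBefore_lt_le {n : ℕ} (hn : 8 ≤ n) (v : Fin n) {z : ℝ} (hz0 : 0 ≤ z) (hz1 : z ≤ 1)
    {s : ℕ} (hs : s ≤ Fintype.card (CEdge n)) :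
    ((Finset.univ.filter (fun ω : EdgeOrdering n => degBefore ω s v < 8)).card : ℝ) * z ^ 8
      ≤ Real.exp (-((1 - z) * (((n : ℝ) - 8) / Fintype.card (CEdge n)) * s))
        * Fintype.card (EdgeOrdering n) := by
  have hn' : (8 : ℝ) ≤ n := by exact_mod_cast hn
  let φ : ℕ → EdgeOrdering n → ℝ := fun s ω =>
    if degBefore ω s v < 8 then z ^ degBefore ω s v else 0
  have hφ0 : ∀ s ω, 0 ≤ φ s ω := by
    intro s ω
    simp only [φ]
    split_ifs
    · positivity
    · exact le_rfl
  have hbound : ∀ s, s ≤ Fintype.card (CEdge n) → ∑ ω, φ s ω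
      ≤ Real.exp (-((1 - z) * (((n : ℝ) - 8) / Fintype.card (CEdge n)) * s)) * Fintype.card (EdgeOrdering n) := by
    intro s
    induction s with
    | zero =>
      intro _
      simp [φ, degBefore]
    | succ s ih =>
      intro hs
      have ih := ih (by omega)
      have hsN : s < Fintype.card (CEdge n) := hs
      have hsN' : (s : ℝ) < Fintype.card (CEdge n) := by exact_mod_cast hsN
      have h1 : ∀ ω, φ (s + 1) ω
          ≤ φ s ω - (1 - z) * Set.indicator {ω | ω ⟨s, hsN⟩ ∈ edgesAt v} (φ s) ω := by
        intro ω
        simp only [φ, degBefore_succ ω hsN, mem_edgesAt, Set.indicator_apply, Set.mem_ofPred_eq]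
        by_cases hv : v ∈ (ω ⟨s, hsN⟩ : Sym2 (Fin n))
        · simp only [if_pos hv]
          split_ifs with h2 h3
          · rw [pow_succ]; apply le_of_eq; ring
          · omega
          · have := pow_nonneg hz0 (degBefore ω s v)
            nlinarith
          · simp
        · simp only [if_neg hv]
          simp
      have h6 := sum_mul_le_sum_indicator_next hsN (φ s) (fun _ => edgesAt v)
        (fun ω ω' h => by simp only [φ, degBefore_congr h]) (fun _ _ _ => rfl) (hφ0 s)
        ((n : ℝ) - 8) (by
          intro ω hd
          have hd : degBefore ω s v < 8 := by
            by_contra hd'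
            exact hd (if_neg hd')
          have h5 := le_card_edgesAt v
          have h6 : countBefore ω s (edgesAt v) = degBefore ω s v := by
            unfold degBefore countBefore
            simp only [mem_edgesAt]
          rw [h6]
          have h7 : n + degBefore ω s v ≤ (edgesAt v).card + 8 := by omega
          have h8 : (n : ℝ) + degBefore ω s v ≤ (edgesAt v).card + 8 := by exact_mod_cast h7
          linarith)
      have h5 := Finset.sum_le_sum (fun ω (_ : ω ∈ Finset.univ) => h1 ω)
      rw [Finset.sum_sub_distrib, ← Finset.mul_sum] at h5
      set A := ∑ ω, Set.indicator {ω | ω ⟨s, hsN⟩ ∈ edgesAt v} (φ s) ω with hA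
      set u := ∑ ω, φ s ω
      have hu0 : 0 ≤ u := Finset.sum_nonneg (fun ω _ => hφ0 s ω)
      set q := ((n : ℝ) - 8) / Fintype.card (CEdge n)
      calc ∑ ω, φ (s + 1) ω ≤ u - (1 - z) * A := h5
        _ ≤ u - (1 - z) * (u * q) := by
          have := mul_le_mul_of_nonneg_left h6 (sub_nonneg.2 hz1)
          linarith
        _ = (-((1 - z) * q) + 1) * u := by ring
        _ ≤ Real.exp (-((1 - z) * q)) * u :=
          mul_le_mul_of_nonneg_right (Real.add_one_le_exp _) hu0
        _ ≤ Real.exp (-((1 - z) * q)) * (Real.exp (-((1 - z) * q * s))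
            * Fintype.card (EdgeOrdering n)) :=
          mul_le_mul_of_nonneg_left ih (Real.exp_pos _).le
        _ = _ := by
          rw [← mul_assoc, ← Real.exp_add]
          push_cast
          ring_nf
  refine le_trans ?_ (hbound s hs)
  rw [← nsmul_eq_mul, ← Finset.sum_const, Finset.sum_filter]
  refine Finset.sum_le_sum (fun ω _ => ?_)
  simp only [φ]
  split_ifs with h
  · exact pow_le_pow_of_le_one hz0 hz1 h.le
  · exact le_rfl

/-- The edges joining `p.1` to a vertex outside `W` congruent to `p.2` modulo `8`. -/
noncomputable def outEdges {n : ℕ} (W : Finset (Fin n)) (p : Fin n × Fin 8) : Finset (CEdge n) :=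
  Finset.univ.filter (fun e => p.1 ∈ (e : Sym2 (Fin n)) ∧
    ∃ x ∈ (e : Sym2 (Fin n)), x ∉ W ∧ (x : ℕ) % 8 = p.2)

/-- The edges at `v` which are contained in `W`. -/
noncomputable def inEdges {n : ℕ} (W : Finset (Fin n)) (v : Fin n) : Finset (CEdge n) :=
  Finset.univ.filter (fun e => v ∈ (e : Sym2 (Fin n)) ∧ ∀ x ∈ (e : Sym2 (Fin n)), x ∈ W)

lemma card_inEdges_le {n : ℕ} (W : Finset (Fin n)) (v : Fin n) :
    (inEdges W v).card ≤ W.card := by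
  have h1 : (inEdges W v).map ⟨Subtype.val, Subtype.val_injective⟩ ⊆ W.image (fun w => s(v, w)) := by
    intro e he
    simp only [Finset.mem_map, inEdges, Finset.mem_filter, Finset.mem_univ, true_and,
      Function.Embedding.coeFn_mk] at he
    obtain ⟨e, ⟨hv, hW⟩, rfl⟩ := he
    obtain ⟨w, hw⟩ := hv
    rw [Finset.mem_image]
    refine ⟨w, hW w ?_, hw.symm⟩
    rw [hw]
    exact Sym2.mem_mk_right v w
  have h2 := Finset.card_le_card h1
  rw [Finset.card_map] at h2
  exact h2.trans Finset.card_image_le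

lemma le_card_mod_eight {n : ℕ} (i : Fin 8) :
    n ≤ 8 * (Finset.univ.filter (fun x : Fin n => (x : ℕ) % 8 = i)).card + 7 := by
  have h : (Finset.range (n / 8)).card
      ≤ (Finset.univ.filter (fun x : Fin n => (x : ℕ) % 8 = i)).card := by
    refine Finset.card_le_card_of_surjOn (fun x => (x : ℕ) / 8) ?_
    intro k hk
    have hk := Finset.mem_range.1 (Finset.mem_coe.1 hk)
    refine ⟨⟨8 * k + i, by omega⟩, ?_, ?_⟩
    · simp only [Finset.coe_filter, Finset.mem_univ, true_and, Set.mem_ofPred_eq]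
      omega
    · simp only
      omega
  rw [Finset.card_range] at h
  omega

lemma le_card_outEdges {n : ℕ} (W : Finset (Fin n)) {p : Fin n × Fin 8} (hp : p.1 ∈ W) :
    n ≤ 8 * ((outEdges W p).card + W.card) + 7 := by
  have h1 := le_card_mod_eight (n := n) p.2
  set X := Finset.univ.filter (fun x : Fin n => (x : ℕ) % 8 = p.2) with hX
  have h2 : X.card ≤ (X \ W).card + W.card := by
    have := Finset.le_card_sdiff W X
    omega
  have h3 : (X \ W).card ≤ (outEdges W p).card := by
    have hne : ∀ x ∈ X \ W, p.1 ≠ x := by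
      rintro x hx rfl
      exact (Finset.mem_sdiff.1 hx).2 hp
    rw [← Finset.card_attach]
    refine Finset.card_le_card_of_injOn
      (fun x => mkEdge (p.1, x.1) (hne x.1 x.2)) ?_ ?_
    · rintro ⟨x, hx⟩ _
      have hx' := hx
      simp only [Finset.mem_sdiff, hX, Finset.mem_filter, Finset.mem_univ, true_and] at hx'
      simp only [outEdges, mkEdge, Finset.coe_filter, Finset.mem_univ, true_and,
        Set.mem_ofPred_eq]
      exact ⟨Sym2.mem_mk_left _ _, x, Sym2.mem_mk_right _ _, hx'.2, hx'.1⟩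
    · intro u _ u' _ h
      have h' := congrArg Subtype.val h
      simp only [mkEdge, Sym2.eq_iff] at h'
      ext
      rcases h' with ⟨-, h⟩ | ⟨h1, h2⟩
      · rw [h]
      · rw [← h1, h2]
  omega

lemma disjoint_outEdges {n : ℕ} {W : Finset (Fin n)} {p q : Fin n × Fin 8} (hp : p.1 ∈ W)
    (hq : q.1 ∈ W) (hpq : p ≠ q) : Disjoint (outEdges W p) (outEdges W q) := by
  rw [Finset.disjoint_left]
  intro e h1 h2
  simp only [outEdges, Finset.mem_filter, Finset.mem_univ, true_and] at h1 h2
  obtain ⟨⟨x, hx⟩, y, hy, hyW, hy8⟩ := h1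
  obtain ⟨h1, y', hy', hyW', hy8'⟩ := h2
  rw [hx, Sym2.mem_iff] at hy hy' h1
  have e1 : y = x := by
    rcases hy with rfl | rfl
    · exact absurd hp hyW
    · rfl
  have e2 : y' = x := by
    rcases hy' with rfl | rfl
    · exact absurd hp hyW'
    · rfl
  subst e1
  subst e2
  refine hpq (Prod.ext ?_ (Fin.ext (hy8.symm.trans hy8')))
  rcases h1 with h1 | h1
  · exact h1.symm
  · exact absurd (h1 ▸ hq) hyW

/-- The event that the pairs in `D` witness that few vertices have all their first eight
edges inside `W`. -/
def Confined {n : ℕ} (W : Finset (Fin n)) (D : Finset (Fin n × Fin 8)) (ω : EdgeOrdering n) :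
    Prop :=
  ∃ f : {p // p ∈ D} → CEdge n, Function.Injective f ∧ (∀ p, f p ∈ inEdges W p.1.1) ∧
    ∀ p, ((outEdges W p.1).filter (fun e => ω.symm e < ω.symm (f p))).card < 8

lemma card_confined_le {n k : ℕ} {W : Finset (Fin n)} {D : Finset (Fin n × Fin 8)}
    (hD : ∀ p ∈ D, p.1 ∈ W) (hk : D.card = k) (hW : 16 * W.card ≤ n) :
    ((Finset.univ.filter (fun ω : EdgeOrdering n => Confined W D ω)).card : ℝ) * ((n : ℝ) / 16) ^ k
      ≤ ((8 : ℝ) * W.card) ^ k * Fintype.card (EdgeOrdering n) := by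
  let F := (Fintype.piFinset (fun p : {p // p ∈ D} => inEdges W p.1.1)).filter
    (fun f => Function.Injective f)
  let A : ({p // p ∈ D} → CEdge n) → Finset (EdgeOrdering n) := fun f =>
    Finset.univ.filter (fun ω => ∀ p ∈ (Finset.univ : Finset {p // p ∈ D}),
      ((outEdges W p.1).filter (fun e => ω.symm e < ω.symm (f p))).card < 8)
  have hF : (F.card : ℝ) ≤ (W.card : ℝ) ^ k := by
    have h1 : F.card ≤ W.card ^ k := by
      refine (Finset.card_filter_le _ _).trans ?_
      rw [Fintype.card_piFinset]
      refine (Finset.prod_le_pow_card _ _ W.card (fun p _ => card_inEdges_le W p.1.1)).trans ?_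
      rw [Finset.card_univ, Fintype.card_coe, hk]
    exact_mod_cast h1
  have hA : ∀ f ∈ F, ((A f).card : ℝ) * ((n : ℝ) / 16) ^ k
      ≤ (8 : ℝ) ^ k * Fintype.card (EdgeOrdering n) := by
    intro f hf
    rw [Finset.mem_filter, Fintype.mem_piFinset] at hf
    have h := card_early_le (N := Fintype.card (CEdge n)) 8 ((n : ℝ) / 16) (by positivity) f
      (fun p => outEdges W p.1) ?_ hf.2 ?_ ?_ Finset.univ
    · rw [Finset.card_univ, Fintype.card_coe, hk] at h
      push_cast at h
      convert! h
    · intro p q hpq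
      have h1 := hf.1 p
      simp only [inEdges, Finset.mem_filter, Finset.mem_univ, true_and] at h1
      simp only [outEdges, Finset.mem_filter, Finset.mem_univ, true_and] at hpq
      obtain ⟨-, x, hx, hxW, -⟩ := hpq
      exact hxW (h1.2 x hx)
    · intro p q hpq
      exact disjoint_outEdges (hD _ p.2) (hD _ q.2) (fun h => hpq (Subtype.ext h))
    · intro p
      have h1 := le_card_outEdges W (hD _ p.2)
      have h2 : n ≤ 16 * ((outEdges W p.1).card + 1) := by omega
      have h3 : (n : ℝ) ≤ 16 * ((outEdges W p.1).card + 1) := by exact_mod_cast h2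
      linarith
  have hsub : Finset.univ.filter (fun ω : EdgeOrdering n => Confined W D ω) ⊆ F.biUnion A := by
    intro ω hω
    obtain ⟨f, hf1, hf2, hf3⟩ := (Finset.mem_filter.1 hω).2
    rw [Finset.mem_biUnion]
    refine ⟨f, ?_, ?_⟩
    · rw [Finset.mem_filter, Fintype.mem_piFinset]
      exact ⟨hf2, hf1⟩
    · exact Finset.mem_filter.2 ⟨Finset.mem_univ _, fun p _ => hf3 p⟩
  have h1 : ((Finset.univ.filter (fun ω : EdgeOrdering n => Confined W D ω)).card : ℝ)
      ≤ ∑ f ∈ F, ((A f).card : ℝ) := by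
    exact_mod_cast (Finset.card_le_card hsub).trans Finset.card_biUnion_le
  calc _ ≤ (∑ f ∈ F, ((A f).card : ℝ)) * ((n : ℝ) / 16) ^ k := by gcongr
    _ = ∑ f ∈ F, ((A f).card : ℝ) * ((n : ℝ) / 16) ^ k := Finset.sum_mul _ _ _
    _ ≤ ∑ _f ∈ F, (8 : ℝ) ^ k * Fintype.card (EdgeOrdering n) := Finset.sum_le_sum hA
    _ = F.card * ((8 : ℝ) ^ k * Fintype.card (EdgeOrdering n)) := by
      rw [Finset.sum_const, nsmul_eq_mul]
    _ ≤ (W.card : ℝ) ^ k * ((8 : ℝ) ^ k * Fintype.card (EdgeOrdering n)) := by gcongr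
    _ = _ := by rw [mul_pow]; ring

lemma mem_extNbr {V : Type} [Fintype V] {G : SimpleGraph V} {S : Finset V} {x : V} :
    x ∈ extNbr G S ↔ x ∉ S ∧ ∃ v ∈ S, G.Adj v x := by
  simp [extNbr]

lemma exists_degBefore_eq {n : ℕ} {ω : EdgeOrdering n} {v : Fin n} {i s : ℕ}
    (hs : s ≤ Fintype.card (CEdge n)) (h : i < degBefore ω s v) :
    ∃ j : Fin (Fintype.card (CEdge n)), (j : ℕ) < s ∧ v ∈ (ω j : Sym2 (Fin n)) ∧
      degBefore ω j v = i := by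
  induction s with
  | zero => simp [degBefore] at h
  | succ s ih =>
    by_cases h1 : i < degBefore ω s v
    · obtain ⟨j, hj, h2⟩ := ih (by omega) h1
      exact ⟨j, by omega, h2⟩
    · rw [degBefore_succ ω hs] at h
      split_ifs at h with hv
      · exact ⟨⟨s, hs⟩, Nat.lt_succ_self s, hv, by simp only; omega⟩
      · omega

lemma card_filter_lt_le_degBefore {n : ℕ} (ω : EdgeOrdering n) (W : Finset (Fin n))
    (p : Fin n × Fin 8) (j : Fin (Fintype.card (CEdge n))) :
    ((outEdges W p).filter (fun e => ω.symm e < j)).card ≤ degBefore ω j p.1 := by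
  refine Finset.card_le_card_of_injOn ω.symm ?_ ω.symm.injective.injOn
  intro e he
  simp only [outEdges, Finset.coe_filter, Finset.mem_filter, Finset.mem_univ, true_and,
    Set.mem_ofPred_eq] at he
  simp only [Finset.coe_filter, Finset.mem_univ, true_and, Set.mem_ofPred_eq,
    Equiv.apply_symm_apply]
  exact ⟨he.2, he.1.1⟩

/-- A failure of expansion is witnessed by a confining set of vertices. -/
lemma exists_confined {n b t₁ d : ℕ} (hb : 9 * n ≤ b) {ω : EdgeOrdering n}
    (ht : t₁ ≤ Fintype.card (CEdge n)) (hdeg : ∀ v, 8 ≤ degBefore ω t₁ v) (hd : 3 * d ≤ n)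
    (hexp : ¬ Expands (toGraph n (build n b (hamStrategy n t₁) ω t₁)) d) :
    ∃ s ∈ Finset.Icc 1 d, ∃ W ∈ Finset.powersetCard (3 * s) (Finset.univ : Finset (Fin n)),
      ∃ D ∈ Finset.powersetCard (4 * s) (W ×ˢ (Finset.univ : Finset (Fin 8))),
        Confined W D ω := by
  unfold Expands at hexp
  push Not at hexp
  obtain ⟨S, hS, hSd, hSN⟩ := hexp
  set G := toGraph n (build n b (hamStrategy n t₁) ω t₁) with hG
  have hW1 : (S ∪ extNbr G S).card ≤ 3 * S.card :=
    (Finset.card_union_le _ _).trans (by omega)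
  obtain ⟨W, hSW, hW⟩ := Finset.exists_superset_card_eq hW1 (by rw [Fintype.card_fin]; omega)
  have hSW' : ∀ v ∈ S, v ∈ W := fun v hv => hSW (Finset.mem_union_left _ hv)
  have hex : ∀ p : Fin n × Fin 8, ∃ j : Fin (Fintype.card (CEdge n)), (j : ℕ) < t₁ ∧
      p.1 ∈ (ω j : Sym2 (Fin n)) ∧ degBefore ω j p.1 = p.2 := fun p =>
    exists_degBefore_eq ht (lt_of_lt_of_le p.2.2 (hdeg p.1))
  choose j hj1 hj2 hj3 using hex
  have hfib : ∀ e ∈ (S ×ˢ (Finset.univ : Finset (Fin 8))).image (fun p => ω (j p)),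
      ((S ×ˢ (Finset.univ : Finset (Fin 8))).filter (fun p => ω (j p) = e)).card ≤ 2 := by
    intro e _
    have h1 : (e : Sym2 (Fin n)).toFinset.card ≤ 2 := by
      rw [Sym2.card_toFinset]
      split_ifs <;> omega
    refine le_trans (Finset.card_le_card_of_injOn Prod.fst ?_ ?_) h1
    · intro p hp
      simp only [Finset.coe_filter, Set.mem_ofPred_eq] at hp
      simp only [Finset.mem_coe, Sym2.mem_toFinset]
      exact hp.2 ▸ hj2 p
    · intro p hp q hq hpq
      simp only [Finset.coe_filter, Set.mem_ofPred_eq] at hp hq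
      have h2 : j p = j q := ω.injective (hp.2.trans hq.2.symm)
      have h3 := hj3 p
      rw [h2, hpq, hj3 q] at h3
      exact Prod.ext hpq (Fin.ext h3.symm)
  have hcard := Finset.card_le_mul_card_image _ 2 hfib
  rw [Finset.card_product, Finset.card_univ, Fintype.card_fin] at hcard
  obtain ⟨T, hT, hTcard⟩ := Finset.exists_subset_card_eq (show 4 * S.card ≤
    ((S ×ˢ (Finset.univ : Finset (Fin 8))).image (fun p => ω (j p))).card by omega)
  have hsurj : Set.SurjOn (fun p => ω (j p)) ↑(S ×ˢ (Finset.univ : Finset (Fin 8))) ↑T := by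
    intro e he
    have := hT he
    rw [Finset.mem_image] at this
    exact this
  obtain ⟨D, hDS, hinj, himg⟩ := Finset.exists_subset_injOn_image_eq_of_surjOn _ _ hsurj
  have hDcard : D.card = 4 * S.card := by
    rw [← hTcard, ← himg, Finset.card_image_of_injOn hinj]
  have hD : ∀ p ∈ D, p.1 ∈ S := fun p hp => (Finset.mem_product.1 (hDS hp)).1
  refine ⟨S.card, Finset.mem_Icc.2 ⟨hS.card_pos, hSd⟩, W,
    Finset.mem_powersetCard.2 ⟨Finset.subset_univ _, hW⟩, D,
    Finset.mem_powersetCard.2 ⟨hDS.trans (Finset.product_subset_product_left hSW'), hDcard⟩,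
    fun p => ω (j p), ?_, ?_, ?_⟩
  · intro p q hpq
    exact Subtype.ext (hinj p.2 q.2 hpq)
  · rintro ⟨p, hp⟩
    have hpS := hD p hp
    simp only [inEdges, Finset.mem_filter, Finset.mem_univ, true_and]
    refine ⟨hj2 p, ?_⟩
    have hmem : ω (j p) ∈ build n b (hamStrategy n t₁) ω t₁ :=
      mem_build_of_degBefore_lt ω hb (hj1 p) (hj2 p) (by rw [hj3 p]; exact p.2.2)
    obtain ⟨y, hy⟩ := hj2 p
    have hadj : G.Adj p.1 y := by
      rw [hG, toGraph_adj]
      exact ⟨_, hmem, hy⟩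
    intro x hx
    rw [hy, Sym2.mem_iff] at hx
    rcases hx with rfl | rfl
    · exact hSW' _ hpS
    · by_cases hxS : x ∈ S
      · exact hSW' _ hxS
      · refine hSW (Finset.mem_union_right _ ?_)
        exact mem_extNbr.2 ⟨hxS, p.1, hpS, hadj⟩
  · rintro ⟨p, hp⟩
    refine lt_of_le_of_lt ?_ p.2.2
    rw [← hj3 p]
    simp only [Equiv.symm_apply_apply]
    exact card_filter_lt_le_degBefore ω W p (j p)

/-- The constant in the union bound for the expansion of the purchased graph. -/
def expansionConst : ℕ := 3 * 2 ^ 24 * 384 ^ 4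

lemma sum_Icc_div_two_pow_le (d : ℕ) : ∑ s ∈ Finset.Icc 1 d, (s : ℝ) / 2 ^ s ≤ 2 := by
  have h : ∑ s ∈ Finset.Icc 1 d, (s : ℝ) / 2 ^ s = 2 - (d + 2) / 2 ^ d := by
    induction d with
    | zero => simp
    | succ d ih =>
      rw [Finset.sum_Icc_succ_top (by omega), ih]
      push_cast
      field_simp
      ring
  rw [h]
  have : (0 : ℝ) ≤ (d + 2) / 2 ^ d := by positivity
  linarith

lemma choose_three_mul_le (n : ℕ) {s : ℕ} (hs : 0 < s) :
    ((n.choose (3 * s) : ℕ) : ℝ) ≤ ((n : ℝ) / s) ^ (3 * s) * 3 ^ s := by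
  have hs' : (0 : ℝ) < s := by exact_mod_cast hs
  have h1 : ((n.choose (3 * s) : ℕ) : ℝ) ≤ (n : ℝ) ^ (3 * s) / (3 * s).factorial :=
    Nat.choose_le_pow_div (3 * s) n
  have h2 : (s : ℝ) ^ (3 * s) / (3 * s).factorial ≤ Real.exp s :=
    Real.pow_div_factorial_le_exp s hs'.le (3 * s)
  have h3 : Real.exp s ≤ 3 ^ s := by
    rw [← mul_one (s : ℝ), Real.exp_nat_mul]
    exact pow_le_pow_left₀ (Real.exp_pos 1).le (by linarith [Real.exp_one_lt_d9]) s
  calc _ ≤ (n : ℝ) ^ (3 * s) / (3 * s).factorial := h1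
    _ = ((n : ℝ) / s) ^ (3 * s) * ((s : ℝ) ^ (3 * s) / (3 * s).factorial) := by
      rw [div_pow]
      field_simp
    _ ≤ _ := mul_le_mul_of_nonneg_left (h2.trans h3) (by positivity)

/-- The graph purchased in the first phase expands with high probability. -/
lemma card_not_expands_le {n b t₁ d : ℕ} (hb : 9 * n ≤ b) (hn : 0 < n)
    (ht : t₁ ≤ Fintype.card (CEdge n)) (hd : d * (2 * expansionConst) ≤ n) :
    ((Finset.univ.filter (fun ω : EdgeOrdering n => (∀ v, 8 ≤ degBefore ω t₁ v) ∧
      ¬ Expands (toGraph n (build n b (hamStrategy n t₁) ω t₁)) d)).card : ℝ)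
      ≤ 4 * expansionConst / n * Fintype.card (EdgeOrdering n) := by
  have hK : 48 ≤ expansionConst := by norm_num [expansionConst]
  have hKd : 48 * d ≤ n := by nlinarith
  have hn' : (0 : ℝ) < n := by exact_mod_cast hn
  have hsub : Finset.univ.filter (fun ω : EdgeOrdering n => (∀ v, 8 ≤ degBefore ω t₁ v) ∧
      ¬ Expands (toGraph n (build n b (hamStrategy n t₁) ω t₁)) d)
      ⊆ (Finset.Icc 1 d).biUnion (fun s =>
        (Finset.powersetCard (3 * s) (Finset.univ : Finset (Fin n))).biUnion (fun W =>
          (Finset.powersetCard (4 * s) (W ×ˢ (Finset.univ : Finset (Fin 8)))).biUnion (fun D =>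
            Finset.univ.filter (fun ω : EdgeOrdering n => Confined W D ω)))) := by
    intro ω hω
    have hω := (Finset.mem_filter.1 hω).2
    obtain ⟨s, hs, W, hW, D, hD, h⟩ := exists_confined hb ht hω.1 (by omega) hω.2
    rw [Finset.mem_biUnion]
    refine ⟨s, hs, ?_⟩
    rw [Finset.mem_biUnion]
    refine ⟨W, hW, ?_⟩
    rw [Finset.mem_biUnion]
    exact ⟨D, hD, Finset.mem_filter.2 ⟨Finset.mem_univ _, h⟩⟩
  set M : ℝ := ((Fintype.card (EdgeOrdering n) : ℕ) : ℝ) with hM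
  have hM0 : 0 ≤ M := Nat.cast_nonneg _
  have hterm : ∀ s ∈ Finset.Icc 1 d,
      ((((Finset.powersetCard (3 * s) (Finset.univ : Finset (Fin n))).biUnion (fun W =>
          (Finset.powersetCard (4 * s) (W ×ˢ (Finset.univ : Finset (Fin 8)))).biUnion (fun D =>
            Finset.univ.filter (fun ω : EdgeOrdering n => Confined W D ω)))).card : ℕ) : ℝ)
      ≤ 2 * expansionConst / n * M * (s / 2 ^ s) := by
    intro s hs
    rw [Finset.mem_Icc] at hs
    have hs0 : (0 : ℝ) < s := by exact_mod_cast hs.1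
    have hone : ∀ W ∈ Finset.powersetCard (3 * s) (Finset.univ : Finset (Fin n)),
        ∀ D ∈ Finset.powersetCard (4 * s) (W ×ˢ (Finset.univ : Finset (Fin 8))),
        ((Finset.univ.filter (fun ω : EdgeOrdering n => Confined W D ω)).card : ℝ)
          ≤ (384 * s / n) ^ (4 * s) * M := by
      intro W hW D hD
      have hW := (Finset.mem_powersetCard.1 hW).2
      have hD := Finset.mem_powersetCard.1 hD
      have h := card_confined_le (n := n) (k := 4 * s) (W := W) (D := D)
        (fun p hp => (Finset.mem_product.1 (hD.1 hp)).1) hD.2 (by omega)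
      rw [hW, ← le_div_iff₀ (by positivity)] at h
      refine h.trans (le_of_eq ?_)
      rw [mul_div_right_comm, ← div_pow]
      congr 2
      push_cast
      field_simp
      norm_num
    have htwo : ∀ W ∈ Finset.powersetCard (3 * s) (Finset.univ : Finset (Fin n)),
        ((((Finset.powersetCard (4 * s) (W ×ˢ (Finset.univ : Finset (Fin 8)))).biUnion (fun D =>
            Finset.univ.filter (fun ω : EdgeOrdering n => Confined W D ω))).card : ℕ) : ℝ)
          ≤ 2 ^ (24 * s) * ((384 * s / n) ^ (4 * s) * M) := by
      intro W hW
      refine (Nat.cast_le.2 Finset.card_biUnion_le).trans ?_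
      push_cast
      refine (Finset.sum_le_card_nsmul _ _ _ (hone W hW)).trans ?_
      rw [nsmul_eq_mul]
      refine mul_le_mul_of_nonneg_right ?_ (by positivity)
      rw [Finset.card_powersetCard, Finset.card_product, (Finset.mem_powersetCard.1 hW).2,
        Finset.card_univ, Fintype.card_fin]
      have := Nat.choose_le_two_pow (3 * s * 8) (4 * s)
      have h24 : 3 * s * 8 = 24 * s := by ring
      rw [h24] at this ⊢
      exact_mod_cast this
    refine (Nat.cast_le.2 Finset.card_biUnion_le).trans ?_
    push_cast
    refine (Finset.sum_le_card_nsmul _ _ _ htwo).trans ?_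
    rw [nsmul_eq_mul, Finset.card_powersetCard, Finset.card_univ, Fintype.card_fin]
    have hKs : (expansionConst : ℝ) * s / n ≤ 1 / 2 := by
      rw [div_le_div_iff₀ hn' two_pos]
      have h1 : s * (2 * expansionConst) ≤ n := le_trans (Nat.mul_le_mul_right _ hs.2) hd
      have h2 : (s : ℝ) * (2 * expansionConst) ≤ n := by exact_mod_cast h1
      linarith
    calc ((n.choose (3 * s) : ℕ) : ℝ) * (2 ^ (24 * s) * ((384 * s / n) ^ (4 * s) * M))
        ≤ (((n : ℝ) / s) ^ (3 * s) * 3 ^ s) *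
          (2 ^ (24 * s) * ((384 * s / n) ^ (4 * s) * M)) :=
          mul_le_mul_of_nonneg_right (choose_three_mul_le n hs.1) (by positivity)
      _ = ((expansionConst : ℝ) * s / n) ^ s * M := by
        have h1 : ((n : ℝ) / s) ^ 3 * 3 * 2 ^ 24 * (384 * s / n) ^ 4
            = (expansionConst : ℝ) * s / n := by
          simp only [expansionConst]
          push_cast
          field_simp
          norm_num
        rw [← h1, mul_pow, mul_pow, mul_pow, ← pow_mul, ← pow_mul, ← pow_mul]
        ring
      _ ≤ (2 * ((expansionConst : ℝ) * s / n) * (1 / 2) ^ s) * M := by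
        refine mul_le_mul_of_nonneg_right ?_ hM0
        obtain ⟨r, rfl⟩ : ∃ r, s = r + 1 := ⟨s - 1, by omega⟩
        rw [pow_succ, pow_succ]
        have h2 : ((expansionConst : ℝ) * ((r + 1 : ℕ) : ℝ) / n) ^ r ≤ (1 / 2) ^ r :=
          pow_le_pow_left₀ (by positivity) hKs r
        have h3 := mul_le_mul_of_nonneg_right h2
          (show 0 ≤ (expansionConst : ℝ) * ((r + 1 : ℕ) : ℝ) / n by positivity)
        linarith
      _ = _ := by
        rw [one_div, inv_pow]
        field_simp
  have h1 : ((Finset.univ.filter (fun ω : EdgeOrdering n => (∀ v, 8 ≤ degBefore ω t₁ v) ∧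
      ¬ Expands (toGraph n (build n b (hamStrategy n t₁) ω t₁)) d)).card : ℝ)
      ≤ ∑ s ∈ Finset.Icc 1 d, 2 * expansionConst / n * M * (s / 2 ^ s) := by
    refine (Nat.cast_le.2 ((Finset.card_le_card hsub).trans Finset.card_biUnion_le)).trans ?_
    push_cast
    exact Finset.sum_le_sum hterm
  rw [← Finset.mul_sum] at h1
  refine h1.trans ?_
  have h2 := mul_le_mul_of_nonneg_left (sum_Icc_div_two_pow_le d)
    (show 0 ≤ 2 * (expansionConst : ℝ) / n * M by positivity)
  refine h2.trans (le_of_eq ?_)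
  ring

lemma Expands.mono {V : Type} [Fintype V] {G G' : SimpleGraph V} {d : ℕ} (h : Expands G d)
    (hG : G ≤ G') : Expands G' d := by
  intro S hS hSd
  refine (h S hS hSd).trans_le (Finset.card_le_card ?_)
  intro x hx
  rw [mem_extNbr] at hx ⊢
  obtain ⟨h1, v, hv, h2⟩ := hx
  exact ⟨h1, v, hv, hG h2⟩

/-- The edges which increase the progress of the graph with edge set `P`. -/
noncomputable def boosters (n : ℕ) (P : Finset (CEdge n)) : Finset (CEdge n) :=
  Finset.univ.filter (fun e => progress (toGraph n P) < progress (toGraph n (insert e P)))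

lemma le_card_boosters {n d : ℕ} (hn : 3 ≤ n) {P : Finset (CEdge n)}
    (hexp : Expands (toGraph n P) d) (hnH : ¬ (toGraph n P).IsHamiltonian) :
    d * d ≤ 2 * (boosters n P).card := by
  obtain ⟨Q, hQ, hQ'⟩ := exists_boosters (by rw [Fintype.card_fin]; exact hn) hexp
    (by convert! hnH)
  have hfib : ∀ e ∈ Q.image (fun p => s(p.1, p.2)),
      (Q.filter (fun p => s(p.1, p.2) = e)).card ≤ 2 := by
    intro e he
    obtain ⟨⟨x, y⟩, -, rfl⟩ := Finset.mem_image.1 he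
    refine (Finset.card_le_card (t := {(x, y), (y, x)}) ?_).trans Finset.card_le_two
    rintro ⟨a, c⟩ h
    have h := (Finset.mem_filter.1 h).2
    simp only [Sym2.eq_iff] at h
    simp only [Finset.mem_insert, Finset.mem_singleton, Prod.mk.injEq]
    exact h
  have h1 := Finset.card_le_mul_card_image _ 2 hfib
  have h2 : Q.image (fun p => s(p.1, p.2))
      ⊆ (boosters n P).map ⟨Subtype.val, Subtype.val_injective⟩ := by
    intro e he
    obtain ⟨p, hp, rfl⟩ := Finset.mem_image.1 he
    obtain ⟨hne, hp'⟩ := hQ' p hp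
    rw [Finset.mem_map]
    refine ⟨mkEdge p hne, ?_, rfl⟩
    simp only [boosters, Finset.mem_filter, Finset.mem_univ, true_and]
    refine hp' _ (toGraph_mono (Finset.subset_insert _ _)) ?_
    rw [toGraph_adj]
    exact ⟨_, Finset.mem_insert_self _ _, rfl⟩
  have h3 := Finset.card_le_card h2
  rw [Finset.card_map] at h3
  omega

/-- After the first phase, an expanding graph is turned into a Hamiltonian one quickly. -/
lemma card_not_isHamiltonian_le {n b t₁ d T : ℕ} (hb : 9 * n ≤ b) (hn : 3 ≤ n) (htT : t₁ ≤ T)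
    (hT : T ≤ Fintype.card (CEdge n)) (hd : 4 * T ≤ d * d) :
    ((Finset.univ.filter (fun ω : EdgeOrdering n =>
      Expands (toGraph n (build n b (hamStrategy n t₁) ω t₁)) d ∧
      ¬ (toGraph n (build n b (hamStrategy n t₁) ω T)).IsHamiltonian)).card : ℝ)
      * (((T : ℝ) - t₁) * ((d : ℝ) * d / 4 / Fintype.card (CEdge n)))
      ≤ n * Fintype.card (EdgeOrdering n) := by
  have : Nonempty (Fin n) := ⟨⟨0, by omega⟩⟩
  let B : EdgeOrdering n → ℕ → Finset (CEdge n) := build n b (hamStrategy n t₁)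
  let U : ℕ → Set (EdgeOrdering n) := fun s =>
    {ω | Expands (toGraph n (B ω t₁)) d ∧ ¬ (toGraph n (B ω s)).IsHamiltonian}
  let φ : ℕ → EdgeOrdering n → ℝ := fun s => (U s).indicator 1
  let f : ℕ → EdgeOrdering n → ℝ := fun s ω => progress (toGraph n (B ω s))
  have hφ0 : ∀ s ω, 0 ≤ φ s ω := fun s ω =>
    Set.indicator_nonneg (fun _ _ => zero_le_one) ω
  have hUcongr : ∀ s, t₁ ≤ s → ∀ ω ω', AgreeBefore s ω ω' → (ω ∈ U s ↔ ω' ∈ U s) := by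
    intro s hs ω ω' h
    have h1 : B ω s = B ω' s := build_congr h
    have h2 : B ω t₁ = B ω' t₁ := build_congr (fun i hi => h i (hi.trans_le hs))
    simp only [U, Set.mem_ofPred_eq, h1, h2]
  have hUmono : ∀ s, s ≤ T → U T ⊆ U s := by
    intro s hs ω hω
    exact ⟨hω.1, fun h => hω.2 (h.mono (toGraph_mono (build_mono hs)))⟩
  have hstep : ∀ s, t₁ ≤ s → s < T →
      (∑ ω, f s ω) + (∑ ω, φ T ω) * ((d : ℝ) * d / 4 / Fintype.card (CEdge n))
        ≤ ∑ ω, f (s + 1) ω := by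
    intro s hs hsT
    have hsN : s < Fintype.card (CEdge n) := hsT.trans_le hT
    have h1 := sum_mul_le_sum_indicator_next hsN (φ s) (fun ω => boosters n (B ω s))
      (fun ω ω' h => by simp only [φ, Set.indicator_apply, hUcongr s hs ω ω' h]; rfl)
      (fun ω ω' h => by
        have : B ω s = B ω' s := build_congr h
        simp only [this])
      (hφ0 s) ((d : ℝ) * d / 4) (by
        intro ω hω
        have hω : ω ∈ U s := by
          by_contra h
          exact hω (Set.indicator_of_notMem h _)
        have h2 := le_card_boosters hn (hω.1.mono (toGraph_mono (build_mono hs))) hω.2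
        have h3 := countBefore_le ω s (boosters n (B ω s))
        have h4 : d * d + 4 * countBefore ω s (boosters n (B ω s))
          ≤ 4 * (boosters n (B ω s)).card := by
          have h2' : d * d ≤ 2 * (boosters n (B ω s)).card := h2
          omega
        have h5 : (d : ℝ) * d + 4 * countBefore ω s (boosters n (B ω s))
          ≤ 4 * (boosters n (B ω s)).card := by exact_mod_cast h4
        linarith)
    have h2 : ∑ ω, φ T ω ≤ ∑ ω, φ s ω := Finset.sum_le_sum (fun ω _ =>
      Set.indicator_le_indicator_of_subset (hUmono s hsT.le) (fun _ => zero_le_one) ω)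
    have h3 : ∀ ω, f s ω + Set.indicator {ω | ω ⟨s, hsN⟩ ∈ boosters n (B ω s)} (φ s) ω
        ≤ f (s + 1) ω := by
      intro ω
      have h4 : progress (toGraph n (B ω s)) ≤ progress (toGraph n (B ω (s + 1))) :=
        progress_mono (toGraph_mono (build_mono (Nat.le_succ s)))
      have h4' : f s ω ≤ f (s + 1) ω := Nat.cast_le.2 h4
      by_cases h5 : ω ⟨s, hsN⟩ ∈ boosters n (B ω s)
      · rw [Set.indicator_of_mem (by exact h5)]
        by_cases h6 : ω ∈ U s
        · have h7 := progress_build_succ (b := b) ω (by omega) hb hs hsN h6.2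
            (Finset.mem_filter.1 h5).2
          have h8 : f s ω + 1 ≤ f (s + 1) ω := by
            simp only [f]
            exact_mod_cast h7
          simpa only [φ, Set.indicator_of_mem h6, Pi.one_apply] using h8
        · simpa only [φ, Set.indicator_of_notMem h6, add_zero] using h4'
      · rw [Set.indicator_of_notMem (by exact h5), add_zero]
        exact h4'
    have h4 := Finset.sum_le_sum (fun ω (_ : ω ∈ Finset.univ) => h3 ω)
    rw [Finset.sum_add_distrib] at h4
    have h5 := mul_le_mul_of_nonneg_right h2
      (show 0 ≤ (d : ℝ) * d / 4 / Fintype.card (CEdge n) by positivity)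
    linarith
  have hall : ∀ s, t₁ ≤ s → s ≤ T → (∑ ω, φ T ω) *
      (((s : ℝ) - t₁) * ((d : ℝ) * d / 4 / Fintype.card (CEdge n))) ≤ ∑ ω, f s ω := by
    intro s hs
    induction s, hs using Nat.le_induction with
    | base =>
      intro _
      rw [sub_self, zero_mul, mul_zero]
      exact Finset.sum_nonneg (fun ω _ => Nat.cast_nonneg _)
    | succ s hs ih =>
      intro hsT
      have h1 := hstep s hs hsT
      have h2 := ih (by omega)
      push_cast
      linarith
  have hfin : ∑ ω, f T ω ≤ n * Fintype.card (EdgeOrdering n) := by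
    refine (Finset.sum_le_card_nsmul _ _ (n : ℝ) (fun ω _ => ?_)).trans ?_
    · have h := progress_le (toGraph n (B ω T))
      rw [Fintype.card_fin] at h
      exact Nat.cast_le.2 h
    · rw [nsmul_eq_mul, Finset.card_univ, mul_comm]
  have hsum : ∑ ω, φ T ω = ((Finset.univ.filter (fun ω : EdgeOrdering n =>
      Expands (toGraph n (build n b (hamStrategy n t₁) ω t₁)) d ∧
      ¬ (toGraph n (build n b (hamStrategy n t₁) ω T)).IsHamiltonian)).card : ℝ) := by
    rw [Finset.card_filter]
    push_cast
    exact Finset.sum_congr rfl (fun ω _ => by simp only [φ, Set.indicator_apply]; rfl)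
  rw [← hsum]
  exact (hall T htT le_rfl).trans hfin

lemma one_sub_le_uprob {n b t₁ T t d : ℕ} {z : ℝ} (hb : 9 * n ≤ b) (hn : 8 ≤ n) (htT : t₁ < T)
    (hT : T ≤ Fintype.card (CEdge n)) (hTt : T ≤ t) (hd0 : 0 < d) (hd : 4 * T ≤ d * d)
    (hdn : d * (2 * expansionConst) ≤ n) (hz0 : 0 < z) (hz1 : z ≤ 1) :
    1 - (n * Real.exp (-((1 - z) * (((n : ℝ) - 8) / Fintype.card (CEdge n)) * t₁)) / z ^ 8
        + 4 * expansionConst / n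
        + n / (((T : ℝ) - t₁) * ((d : ℝ) * d / 4 / Fintype.card (CEdge n))))
      ≤ uprob (fun ω : EdgeOrdering n =>
        (toGraph n (build n b (hamStrategy n t₁) ω t)).IsHamiltonian) := by
  set M : ℝ := ((Fintype.card (EdgeOrdering n) : ℕ) : ℝ) with hM
  have hMpos : 0 < M := by
    have : Nonempty (EdgeOrdering n) := ⟨(Fintype.equivFin _).symm⟩
    exact Nat.cast_pos.2 Fintype.card_pos
  let A : Finset (EdgeOrdering n) := Finset.univ.biUnion (fun v : Fin n =>
    Finset.univ.filter (fun ω : EdgeOrdering n => degBefore ω t₁ v < 8))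
  let B : Finset (EdgeOrdering n) :=
    Finset.univ.filter (fun ω : EdgeOrdering n => (∀ v, 8 ≤ degBefore ω t₁ v) ∧
      ¬ Expands (toGraph n (build n b (hamStrategy n t₁) ω t₁)) d)
  let C : Finset (EdgeOrdering n) := Finset.univ.filter (fun ω : EdgeOrdering n =>
      Expands (toGraph n (build n b (hamStrategy n t₁) ω t₁)) d ∧
      ¬ (toGraph n (build n b (hamStrategy n t₁) ω T)).IsHamiltonian)
  let H : Finset (EdgeOrdering n) := Finset.univ.filter (fun ω : EdgeOrdering n =>
        (toGraph n (build n b (hamStrategy n t₁) ω t)).IsHamiltonian)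
  have hA : (A.card : ℝ) ≤
      n * Real.exp (-((1 - z) * (((n : ℝ) - 8) / Fintype.card (CEdge n)) * t₁)) / z ^ 8 * M := by
    refine (Nat.cast_le.2 Finset.card_biUnion_le).trans ?_
    push_cast
    refine (Finset.sum_le_card_nsmul _ _
      (Real.exp (-((1 - z) * (((n : ℝ) - 8) / Fintype.card (CEdge n)) * t₁)) * M / z ^ 8)
      (fun v _ => ?_)).trans (le_of_eq ?_)
    · rw [le_div_iff₀ (by positivity)]
      exact card_degBefore_lt_le hn v hz0.le hz1 (htT.le.trans hT)
    · rw [nsmul_eq_mul, Finset.card_univ, Fintype.card_fin]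
      ring
  have hB : (B.card : ℝ) ≤ 4 * expansionConst / n * M :=
    card_not_expands_le hb (by omega) (htT.le.trans hT) hdn
  have htT' : (0 : ℝ) < (T : ℝ) - t₁ := sub_pos.2 (by exact_mod_cast htT)
  have hN : (0 : ℝ) < Fintype.card (CEdge n) := by
    have : 0 < Fintype.card (CEdge n) := by omega
    exact_mod_cast this
  have hd0' : (0 : ℝ) < d := by exact_mod_cast hd0
  have hC : (C.card : ℝ)
      ≤ n / (((T : ℝ) - t₁) * ((d : ℝ) * d / 4 / Fintype.card (CEdge n))) * M := by
    rw [div_mul_eq_mul_div, le_div_iff₀ (by positivity)]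
    exact card_not_isHamiltonian_le hb (by omega) htT.le hT hd
  have hcov : (Finset.univ : Finset (EdgeOrdering n)) ⊆ H ∪ (A ∪ (B ∪ C)) := by
    intro ω _
    simp only [Finset.mem_union, H, A, B, C, Finset.mem_biUnion, Finset.mem_filter,
      Finset.mem_univ, true_and]
    by_cases h1 : ∃ v, degBefore ω t₁ v < 8
    · exact Or.inr (Or.inl h1)
    push Not at h1
    by_cases h2 : Expands (toGraph n (build n b (hamStrategy n t₁) ω t₁)) d
    · by_cases h3 : (toGraph n (build n b (hamStrategy n t₁) ω T)).IsHamiltonian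
      · exact Or.inl (h3.mono (toGraph_mono (build_mono hTt)))
      · exact Or.inr (Or.inr (Or.inr ⟨h2, h3⟩))
    · exact Or.inr (Or.inr (Or.inl ⟨h1, h2⟩))
  have h1 : Fintype.card (EdgeOrdering n) ≤ H.card + (A.card + (B.card + C.card)) := by
    rw [← Finset.card_univ]
    refine (Finset.card_le_card hcov).trans ?_
    refine (Finset.card_union_le _ _).trans (Nat.add_le_add_left ?_ _)
    refine (Finset.card_union_le _ _).trans (Nat.add_le_add_left ?_ _)
    exact Finset.card_union_le _ _
  have h2 : M ≤ H.card + (A.card + (B.card + C.card)) := by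
    rw [hM]
    exact_mod_cast h1
  have h3 : uprob (fun ω : EdgeOrdering n =>
        (toGraph n (build n b (hamStrategy n t₁) ω t)).IsHamiltonian) = (H.card : ℝ) / M := by
    unfold uprob
    rfl
  rw [h3, le_div_iff₀ hMpos]
  linarith

lemma uprob_le_one {α : Type} [Fintype α] (P : α → Prop) : uprob P ≤ 1 := by
  unfold uprob
  refine div_le_one_of_le₀ ?_ (Nat.cast_nonneg _)
  exact_mod_cast Finset.card_le_univ _

lemma cast_card_cEdge (n : ℕ) : (Fintype.card (CEdge n) : ℝ) = n * ((n : ℝ) - 1) / 2 := by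
  rw [card_cEdge, Nat.cast_choose_two]

lemma mul_exp_neg_le {x y ε : ℝ} (hε0 : 0 < ε) (hε1 : ε ≤ 1) (hx : 8 ≤ x)
    (hx1 : (1 - ε / 16) * (x - 1) ≤ x - 8) (hy : (1 + ε / 2) * x * Real.log x / 2 ≤ y) :
    x * Real.exp (-((1 - ε / 16) * ((x - 8) / (x * (x - 1) / 2)) * y))
      ≤ Real.exp (-(ε / 4 * Real.log x)) := by
  have hxpos : 0 < x := by linarith
  have hx1pos : 0 < x - 1 := by linarith
  have hL : 0 < Real.log x := Real.log_pos (by linarith)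
  have hz : 0 ≤ 1 - ε / 16 := by linarith
  have h1 : (1 - ε / 16) * (2 / x) ≤ (x - 8) / (x * (x - 1) / 2) := by
    rw [le_div_iff₀ (by positivity)]
    refine le_trans (le_of_eq ?_) hx1
    field_simp
  have h2 : (1 + ε / 4) * Real.log x
      ≤ (1 - ε / 16) * ((x - 8) / (x * (x - 1) / 2)) * y := by
    have h3 : (1 - ε / 16) * ((1 - ε / 16) * (2 / x)) * ((1 + ε / 2) * x * Real.log x / 2)
        ≤ (1 - ε / 16) * ((x - 8) / (x * (x - 1) / 2)) * y :=
      mul_le_mul (mul_le_mul_of_nonneg_left h1 hz) hy (by positivity)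
        (mul_nonneg hz (div_nonneg (by linarith) (by positivity)))
    refine le_trans ?_ h3
    have h4 : (1 - ε / 16) * ((1 - ε / 16) * (2 / x)) * ((1 + ε / 2) * x * Real.log x / 2)
        = (1 - ε / 16) ^ 2 * (1 + ε / 2) * Real.log x := by
      field_simp
    rw [h4]
    refine mul_le_mul_of_nonneg_right ?_ hL.le
    have h5 : 1 - ε / 8 ≤ (1 - ε / 16) ^ 2 := by nlinarith [sq_nonneg ε]
    have h6 := mul_le_mul_of_nonneg_right h5 (show 0 ≤ 1 + ε / 2 by positivity)
    nlinarith
  calc x * Real.exp (-((1 - ε / 16) * ((x - 8) / (x * (x - 1) / 2)) * y))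
      = Real.exp (Real.log x - (1 - ε / 16) * ((x - 8) / (x * (x - 1) / 2)) * y) := by
        rw [sub_eq_add_neg (Real.log x), Real.exp_add, Real.exp_log hxpos]
    _ ≤ _ := Real.exp_le_exp.2 (by linarith)

lemma div_mul_le_of_le {x L κ ε D d : ℝ} (hε0 : 0 < ε) (hx : 1 < x) (hL : 0 < L) (hκ : 0 < κ)
    (hD : ε * (x * L) / 8 ≤ D) (hd : x ^ 2 / (16 * κ ^ 2) ≤ d * d) :
    x / (D * (d * d / 4 / (x * (x - 1) / 2))) ≤ 256 * κ ^ 2 / (ε * L) := by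
  have hx1pos : 0 < x - 1 := by linarith
  have h1 : 1 / (32 * κ ^ 2) ≤ d * d / 4 / (x * (x - 1) / 2) := by
    rw [div_div, div_le_div_iff₀ (by positivity) (by positivity)]
    rw [div_le_iff₀ (by positivity)] at hd
    have h2 : 4 * (x * (x - 1) / 2) ≤ 2 * x ^ 2 := by nlinarith
    linarith
  have h2 : ε * (x * L) / 8 * (1 / (32 * κ ^ 2)) ≤ D * (d * d / 4 / (x * (x - 1) / 2)) :=
    mul_le_mul hD h1 (by positivity) (le_trans (by positivity) hD)
  refine (div_le_div_of_nonneg_left (by linarith) (by positivity) h2).trans (le_of_eq ?_)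
  field_simp
  norm_num

lemma one_sub_le_uprob_hamStrategy {n b t : ℕ} {ε : ℝ} (hε0 : 0 < ε) (hε1 : ε ≤ 1)
    (hb : 9 * n ≤ b) (ht : (1 + ε) * n * Real.log n / 2 ≤ t) (hn : 8 ≤ n)
    (hnK : 4 * expansionConst ≤ n) (hn1 : (1 - ε / 16) * ((n : ℝ) - 1) ≤ (n : ℝ) - 8)
    (hn2 : 8 ≤ ε * (n * Real.log n))
    (hn3 : 64 * (expansionConst : ℝ) ^ 2 * (n * Real.log n + 1) ≤ (n : ℝ) ^ 2) :
    1 - (Real.exp (-(ε / 4 * Real.log n)) / (ε / 16) ^ 8 + 4 * expansionConst / n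
        + 256 * (expansionConst : ℝ) ^ 2 / (ε * Real.log n))
      ≤ uprob (fun ω : EdgeOrdering n => (toGraph n (build n b
        (hamStrategy n ⌈(1 + ε / 2) * n * Real.log n / 2⌉₊) ω t)).IsHamiltonian) := by
  set L := Real.log n with hL
  set t₁ := ⌈(1 + ε / 2) * n * L / 2⌉₊ with ht₁
  set T := ⌈(1 + ε) * n * L / 2⌉₊ with hT
  set d := n / (2 * expansionConst) with hd
  have hn' : (8 : ℝ) ≤ n := by exact_mod_cast hn
  have hnpos : (0 : ℝ) < n := by linarith
  have hLpos : 0 < L := Real.log_pos (by linarith)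
  have hKpos : 0 < expansionConst := by norm_num [expansionConst]
  set κ : ℝ := (expansionConst : ℝ) with hκ
  have hκ1 : 1 ≤ κ := by rw [hκ]; exact_mod_cast hKpos
  have hnL : 0 < n * L := by positivity
  have ht₁l : (1 + ε / 2) * n * L / 2 ≤ t₁ := Nat.le_ceil _
  have ht₁u : (t₁ : ℝ) < (1 + ε / 2) * n * L / 2 + 1 := Nat.ceil_lt_add_one (by positivity)
  have hTl : (1 + ε) * n * L / 2 ≤ T := Nat.le_ceil _
  have hTu : (T : ℝ) < (1 + ε) * n * L / 2 + 1 := Nat.ceil_lt_add_one (by positivity)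
  have hdiff : ε * (n * L) / 8 ≤ (T : ℝ) - t₁ := by nlinarith
  have hT1 : (T : ℝ) ≤ n * L + 1 := by nlinarith
  have hdn : d * (2 * expansionConst) ≤ n := Nat.div_mul_le_self _ _
  have hdl : (n : ℝ) / (4 * κ) ≤ d := by
    have h1 : n < 2 * expansionConst * (d + 1) := Nat.lt_mul_div_succ n (by omega)
    have h2 : n ≤ 4 * expansionConst * d := by nlinarith
    rw [div_le_iff₀ (by positivity)]
    have h3 : (n : ℝ) ≤ 4 * expansionConst * d := by exact_mod_cast h2
    linarith
  have hdd : (n : ℝ) ^ 2 / (16 * κ ^ 2) ≤ (d : ℝ) * d := by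
    have h1 := mul_le_mul hdl hdl (by positivity) (Nat.cast_nonneg d)
    refine le_trans (le_of_eq ?_) h1
    field_simp
    norm_num
  have hTd : 4 * T ≤ d * d := by
    have h1 : 4 * (n * L + 1) ≤ (n : ℝ) ^ 2 / (16 * κ ^ 2) := by
      rw [le_div_iff₀ (by positivity)]
      linarith
    have h2 : (4 : ℝ) * T ≤ (d : ℝ) * d := by linarith
    exact_mod_cast h2
  have hd0 : 0 < d := by
    have : (0 : ℝ) < d := lt_of_lt_of_le (by positivity) hdl
    exact_mod_cast this
  have hN := cast_card_cEdge n
  have hTN : T ≤ Fintype.card (CEdge n) := by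
    have h1 : 2 * d ≤ n := by nlinarith
    have h2 : (2 : ℝ) * d ≤ n := by exact_mod_cast h1
    have h3 : (4 : ℝ) * T ≤ (d : ℝ) * d := by exact_mod_cast hTd
    have h4 : (T : ℝ) ≤ Fintype.card (CEdge n) := by
      rw [hN]
      have : (0 : ℝ) ≤ d := Nat.cast_nonneg d
      nlinarith
    exact_mod_cast h4
  have htT : t₁ < T := by
    have : (t₁ : ℝ) < T := by
      have : 0 < ε * (n * L) / 8 := by positivity
      linarith
    exact_mod_cast this
  have hNpos : (0 : ℝ) < Fintype.card (CEdge n) := by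
    rw [hN]
    have : (0 : ℝ) < (n : ℝ) - 1 := by linarith
    positivity
  refine le_trans ?_ (one_sub_le_uprob (z := ε / 16) hb hn htT hTN (Nat.ceil_le.2 ht) hd0 hTd hdn
    (by positivity) (by linarith))
  have hterm1 : n * Real.exp (-((1 - ε / 16) * (((n : ℝ) - 8) / Fintype.card (CEdge n)) * t₁))
      ≤ Real.exp (-(ε / 4 * L)) := by
    rw [hN]
    exact mul_exp_neg_le hε0 hε1 hn' hn1 ht₁l
  have hterm3 : n / (((T : ℝ) - t₁) * ((d : ℝ) * d / 4 / Fintype.card (CEdge n)))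
      ≤ 256 * κ ^ 2 / (ε * L) := by
    rw [hN]
    exact div_mul_le_of_le hε0 (by linarith) hLpos (by linarith) hdiff hdd
  have hterm1' := div_le_div_of_nonneg_right hterm1 (show 0 ≤ (ε / 16) ^ 8 by positivity)
  linarith

/-- Hamiltonicity, optimal time: if `t ≥ (1+ε) n log n / 2` and `b ≥ 9n`, Builder has a
`(t,b)`-strategy whose purchased graph is Hamiltonian with high probability. -/
theorem stmt2 (ε : ℝ) (hε : 0 < ε) (t b : ℕ → ℕ)
    (ht : ∀ n : ℕ, (1 + ε) * n * Real.log n / 2 ≤ (t n : ℝ))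
    (hb : ∀ n : ℕ, 9 * n ≤ b n) :
    ∃ S : (n : ℕ) → Strategy n,
      Tendsto
        (fun n => uprob (fun ω : EdgeOrdering n =>
          (toGraph n (build n (b n) (S n) ω (t n))).IsHamiltonian))
        atTop (nhds 1) := by
  set δ := min ε 1 with hδ
  have hδ0 : 0 < δ := lt_min hε one_pos
  have hδ1 : δ ≤ 1 := min_le_right _ _
  refine ⟨fun n => hamStrategy n ⌈(1 + δ / 2) * n * Real.log n / 2⌉₊, ?_⟩
  have hcast : Tendsto (fun n : ℕ => (n : ℝ)) atTop atTop := tendsto_natCast_atTop_atTop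
  have hlog : Tendsto (fun n : ℕ => Real.log n) atTop atTop := Real.tendsto_log_atTop.comp hcast
  have hlim : Tendsto (fun n : ℕ => 1 - (Real.exp (-(δ / 4 * Real.log n)) / (δ / 16) ^ 8
      + 4 * expansionConst / n + 256 * (expansionConst : ℝ) ^ 2 / (δ * Real.log n)))
      atTop (nhds 1) := by
    have h1 : Tendsto (fun n : ℕ => Real.exp (-(δ / 4 * Real.log n)) / (δ / 16) ^ 8)
        atTop (nhds 0) := by
      have := (Real.tendsto_exp_neg_atTop_nhds_zero.comp
        (hlog.const_mul_atTop (show 0 < δ / 4 by positivity))).div_const ((δ / 16) ^ 8)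
      rw [zero_div] at this
      exact this
    have h2 : Tendsto (fun n : ℕ => 4 * (expansionConst : ℝ) / n) atTop (nhds 0) :=
      tendsto_const_nhds.div_atTop hcast
    have h3 : Tendsto (fun n : ℕ => 256 * (expansionConst : ℝ) ^ 2 / (δ * Real.log n))
        atTop (nhds 0) := tendsto_const_nhds.div_atTop (hlog.const_mul_atTop hδ0)
    have h4 := ((h1.add h2).add h3).const_sub 1
    rw [add_zero, add_zero, sub_zero] at h4
    exact h4
  refine tendsto_of_tendsto_of_tendsto_of_le_of_le' hlim tendsto_const_nhds ?_
    (Eventually.of_forall (fun n => uprob_le_one _))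
  have he3 : ∀ᶠ n : ℕ in atTop,
      64 * (expansionConst : ℝ) ^ 2 * (n * Real.log n + 1) ≤ (n : ℝ) ^ 2 := by
    have hK : (0 : ℝ) < 128 * (expansionConst : ℝ) ^ 2 := by
      norm_num [expansionConst]
    have h1 : ∀ᶠ n : ℕ in atTop, Real.log n ≤ 1 / (128 * (expansionConst : ℝ) ^ 2) * n := by
      have := hcast.eventually (Real.isLittleO_log_id_atTop.bound (one_div_pos.2 hK))
      filter_upwards [this] with n hn
      simp only [id, Real.norm_eq_abs, Nat.abs_cast] at hn
      exact (le_abs_self _).trans hn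
    filter_upwards [h1, hcast.eventually_ge_atTop (128 * (expansionConst : ℝ) ^ 2),
      hcast.eventually_ge_atTop 1] with n h2 h3 h4
    rw [one_div_mul_eq_div, le_div_iff₀ hK] at h2
    have h5 := mul_le_mul_of_nonneg_left h2 (show (0 : ℝ) ≤ n by linarith)
    nlinarith
  filter_upwards [eventually_ge_atTop 8, eventually_ge_atTop (4 * expansionConst),
    hcast.eventually_ge_atTop (128 / δ), hlog.eventually_ge_atTop 1, he3] with n h1 h2 h3 h4 h5
  rw [div_le_iff₀ hδ0] at h3
  have h8 : (8 : ℝ) ≤ n := by exact_mod_cast h1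
  refine one_sub_le_uprob_hamStrategy hδ0 hδ1 (hb n) ?_ h1 h2 (by nlinarith) ?_ h5
  · refine le_trans ?_ (ht n)
    have : δ ≤ ε := min_le_left _ _
    gcongr
  · have : n * 1 ≤ (n : ℝ) * Real.log n := mul_le_mul_of_nonneg_left h4 (by linarith)
    nlinarith
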